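/- arXiv:1409.6134 — 2 statements merged into one kernel-verified Lean document; each statement's English description precedes it below -/
import Mathlib

section
/- Let T be an ergodic automorphism of a standard probability space (X,μ), and let {h_n} be a scaling entropy sequence of the system (X,μ,T). Then the Kolmogorov entropy h_μ(T) equals 0 if and only if h_n = o(n) as n → +∞. -/
open MeasureTheory Filter Set
open scoped ENNReal

/-- A semimetric on a set: symmetric, nonnegative, vanishing on the diagonal,
satisfying the triangle inequality. -/
structure IsSemimetric {Y : Type*} (ρ : Y → Y → ℝ) : Prop where
  refl : ∀ x, ρ x x = 0
  symm : ∀ x y, ρ x y = ρ y x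
  nonneg : ∀ x y, 0 ≤ ρ x y
  triangle : ∀ x y z, ρ x z ≤ ρ x y + ρ y z

/-- `ρ` is separable on the set `s`: some countable subset of `s` is `ρ`-dense in `s`. -/
def SeparableWRT {Y : Type*} (ρ : Y → Y → ℝ) (s : Set Y) : Prop :=
  ∃ D : Set Y, D.Countable ∧ D ⊆ s ∧ ∀ x ∈ s, ∀ ε : ℝ, 0 < ε → ∃ y ∈ D, ρ x y < ε

variable {X : Type*} [MeasurableSpace X]

/-- A semimetric is admissible if it is separable on a measurable subset of full measure. -/
def IsAdmissible (μ : Measure X) (ρ : X → X → ℝ) : Prop :=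
  ∃ s : Set X, MeasurableSet s ∧ μ sᶜ = 0 ∧ SeparableWRT ρ s

/-- There is a partition `X₀, X₁, …, X_k` of `X` into measurable pieces with `μ X₀ < ε`
and the `ρ`-diameter of `X_j` (1 ≤ j ≤ k) less than `ε`. -/
def IsEntropyPartition (μ : Measure X) (ρ : X → X → ℝ) (ε : ℝ) (k : ℕ) : Prop :=
  ∃ P : Fin (k + 1) → Set X,
    (∀ j, MeasurableSet (P j)) ∧
    Pairwise (fun i j => Disjoint (P i) (P j)) ∧
    (⋃ j, P j) = Set.univ ∧
    μ (P 0) < ENNReal.ofReal ε ∧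
    ∀ j, j ≠ 0 → ∀ x ∈ P j, ∀ y ∈ P j, ρ x y < ε

open scoped Classical in
/-- The Kolmogorov ε-entropy `ℍ_ε(X, μ, ρ)` of a semimetric triple: `log₂ k` for the least
`k` admitting an entropy partition, and `∞` if there is none. -/
noncomputable def epsEntropy (μ : Measure X) (ρ : X → X → ℝ) (ε : ℝ) : ℝ≥0∞ :=
  if h : ∃ k, IsEntropyPartition μ ρ ε k
  then ENNReal.ofReal (Real.logb 2 (Nat.find h))
  else ⊤

/-- The shift `T^k ρ` of a semimetric by the `k`-th power (k ∈ ℤ) of an automorphism. -/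
def shiftSemimetric (T : Equiv.Perm X) (k : ℤ) (ρ : X → X → ℝ) : X → X → ℝ :=
  fun x y => ρ ((T ^ k) x) ((T ^ k) y)

/-- The average `T^n_av ρ = (1/n) ∑_{k=0}^{n-1} T^k ρ`. -/
noncomputable def avgSemimetric (T : Equiv.Perm X) (ρ : X → X → ℝ) (n : ℕ) : X → X → ℝ :=
  fun x y => (∑ k ∈ Finset.range n, ρ ((T ^ k) x) ((T ^ k) y)) / n

/-- `h` is a scaling sequence for the semimetric `ρ` w.r.t. the automorphism `T`:
`h` is positive, for every `ε > 0` the sequence `ℍ_ε(X, μ, T^n_av ρ)/h_n` has finite limsup,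
and for all sufficiently small `ε > 0` it has positive liminf. Sequences are indexed by
`n = 1, 2, …`. -/
def IsScalingSeq (μ : Measure X) (T : Equiv.Perm X) (ρ : X → X → ℝ) (h : ℕ → ℝ) : Prop :=
  (∀ n, 1 ≤ n → 0 < h n) ∧
  (∀ ε : ℝ, 0 < ε →
    Filter.limsup (fun n : ℕ =>
      epsEntropy μ (avgSemimetric T ρ n) ε / ENNReal.ofReal (h n)) Filter.atTop < ⊤) ∧
  (∃ ε₀ : ℝ, 0 < ε₀ ∧ ∀ ε : ℝ, 0 < ε → ε < ε₀ →
    0 < Filter.liminf (fun n : ℕ =>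
      epsEntropy μ (avgSemimetric T ρ n) ε / ENNReal.ofReal (h n)) Filter.atTop)

/-- `ρ` is (two-sided) generating for `(X, μ, T)`: the shifts `T^k ρ`, `k ∈ ℤ`, separate points
of a subset of full measure. -/
def IsGenerating (μ : Measure X) (T : Equiv.Perm X) (ρ : X → X → ℝ) : Prop :=
  ∃ s : Set X, MeasurableSet s ∧ μ sᶜ = 0 ∧
    ∀ x ∈ s, ∀ y ∈ s, x ≠ y → ∃ k : ℤ, 0 < ρ ((T ^ k) x) ((T ^ k) y)

/-- `h` is a scaling entropy sequence of the system `(X, μ, T)`: it is a scaling sequence for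
some summable admissible measurable generating semimetric. -/
def IsScalingEntropySeq (μ : Measure X) (T : Equiv.Perm X) (h : ℕ → ℝ) : Prop :=
  ∃ ρ : X → X → ℝ, IsSemimetric ρ ∧
    Measurable (fun p : X × X => ρ p.1 p.2) ∧
    MeasureTheory.Integrable (fun p : X × X => ρ p.1 p.2) (μ.prod μ) ∧
    IsAdmissible μ ρ ∧ IsGenerating μ T ρ ∧ IsScalingSeq μ T ρ h

/-- The (Shannon) entropy, base 2, of the countable partition of `X` into the fibers of `f`. -/
noncomputable def partitionEntropy {ι : Type*} [Countable ι] (μ : Measure X) (f : X → ι) :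
    ℝ≥0∞ :=
  ∑' i : ι, ENNReal.ofReal (-((μ (f ⁻¹' {i})).toReal * Real.logb 2 (μ (f ⁻¹' {i})).toReal))

/-- The Kolmogorov (measure-theoretic) entropy of the automorphism `T`: the supremum over all
finite measurable partitions `ξ` of `lim_n H(ξ ∨ T⁻¹ξ ∨ ⋯ ∨ T^{-(n-1)}ξ)/n`. -/
noncomputable def kolmogorovEntropy (μ : Measure X) (T : Equiv.Perm X) : ℝ≥0∞ :=
  ⨆ (m : ℕ) (ξ : X → Fin m) (_ : ∀ i, MeasurableSet (ξ ⁻¹' {i})),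
    Filter.limsup (fun n : ℕ =>
      partitionEntropy μ (fun x => fun i : Fin n => ξ ((T ^ (-(i : ℤ))) x)) / (n : ℝ≥0∞))
      Filter.atTop

/-- The Kushnirenko `A`-entropy of `T` along the sequence `A = {a_n}`: the supremum over all
countable measurable partitions `ξ` of finite entropy of
`limsup_n H(T^{a_1}ξ ∨ ⋯ ∨ T^{a_n}ξ)/n`. -/
noncomputable def kushnirenkoEntropy (μ : Measure X) (T : Equiv.Perm X) (a : ℕ → ℕ) : ℝ≥0∞ :=
  ⨆ (ξ : X → ℕ) (_ : ∀ i, MeasurableSet (ξ ⁻¹' {i})) (_ : partitionEntropy μ ξ < ⊤),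
    Filter.limsup (fun n : ℕ =>
      partitionEntropy μ (fun x => fun i : Fin n => ξ ((T ^ (a i)) x)) / (n : ℝ≥0∞))
      Filter.atTop

/-- The Koopman operator `f ↦ f ∘ T` on `L²(X, μ)` has purely point spectrum: `L²(X, μ)`
possesses an orthonormal (Hilbert) basis consisting of eigenfunctions of `f ↦ f ∘ T`. -/
def HasPurePointSpectrum (μ : Measure X) (T : X → X) : Prop :=
  ∃ (ι : Type) (b : HilbertBasis ι ℂ (MeasureTheory.Lp ℂ 2 μ)),
    ∀ i : ι, ∃ c : ℂ, (fun x => (b i : MeasureTheory.Lp ℂ 2 μ) (T x))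
      =ᵐ[μ] fun x => c * (b i : MeasureTheory.Lp ℂ 2 μ) x


/-- Real-valued Shannon entropy (base 2) of a finite-valued map. -/
noncomputable def finEntropy {ι : Type*} [Fintype ι] (μ : Measure X) (f : X → ι) : ℝ :=
  ∑ i, -((μ (f ⁻¹' {i})).toReal * Real.logb 2 (μ (f ⁻¹' {i})).toReal)

lemma neg_mul_logb_nonneg {p : ℝ} (h0 : 0 ≤ p) (h1 : p ≤ 1) : 0 ≤ -(p * Real.logb 2 p) := by
  have := Real.logb_nonpos (b := 2) (by norm_num) h0 h1
  nlinarith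

lemma toReal_measure_le_one (μ : Measure X) [IsProbabilityMeasure μ] (s : Set X) :
    (μ s).toReal ≤ 1 := by
  have := measureReal_le_one (μ := μ) (s := s)
  simpa [Measure.real] using this

lemma partitionEntropy_eq {ι : Type*} [Fintype ι] (μ : Measure X) [IsProbabilityMeasure μ]
    (f : X → ι) : partitionEntropy μ f = ENNReal.ofReal (finEntropy μ f) := by
  unfold partitionEntropy finEntropy
  rw [tsum_fintype, ENNReal.ofReal_sum_of_nonneg]
  intro i _
  exact neg_mul_logb_nonneg ENNReal.toReal_nonneg (toReal_measure_le_one μ _)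

lemma finEntropy_nonneg {ι : Type*} [Fintype ι] (μ : Measure X) [IsProbabilityMeasure μ]
    (f : X → ι) : 0 ≤ finEntropy μ f :=
  Finset.sum_nonneg fun _ _ =>
    neg_mul_logb_nonneg ENNReal.toReal_nonneg (toReal_measure_le_one μ _)

lemma mp_pow (μ : Measure X) (T : Equiv.Perm X) (hT : MeasurePreserving T μ μ) (n : ℕ) :
    MeasurePreserving (⇑(T ^ n)) μ μ := by
  rw [← Equiv.Perm.iterate_eq_pow]
  exact hT.iterate n

lemma mp_inv (μ : Measure X) (T : Equiv.Perm X) (hT : MeasurePreserving T μ μ)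
    (hTsymm : Measurable (⇑T.symm)) : MeasurePreserving (⇑(T⁻¹)) μ μ := by
  let e : X ≃ᵐ X := ⟨T, hT.measurable, hTsymm⟩
  exact MeasurePreserving.symm e hT

lemma mp_zpow (μ : Measure X) (T : Equiv.Perm X) (hT : MeasurePreserving T μ μ)
    (hTsymm : Measurable (⇑T.symm)) (k : ℤ) : MeasurePreserving (⇑(T ^ k)) μ μ := by
  rcases k with n | n
  · simpa using mp_pow μ T hT n
  · have := mp_pow μ T⁻¹ (mp_inv μ T hT hTsymm) (n + 1)
    rw [zpow_negSucc, ← inv_pow]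
    exact this

/-- The `n`-name of a point. -/
def nName {ι : Type*} (T : Equiv.Perm X) (ξ : X → ι) (n : ℕ) (x : X) : Fin n → ι :=
  fun i => ξ ((T ^ (i : ℕ)) x)

lemma measurableSet_nName {m : ℕ} (μ : Measure X) (T : Equiv.Perm X)
    (hT : MeasurePreserving T μ μ)
    (ξ : X → Fin m) (hξ : ∀ i, MeasurableSet (ξ ⁻¹' {i})) (n : ℕ) (w : Fin n → Fin m) :
    MeasurableSet (nName T ξ n ⁻¹' {w}) := by
  have hm : Measurable (nName T ξ n) := by
    refine measurable_pi_lambda _ fun i => ?_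
    exact (measurable_to_countable' hξ).comp (mp_pow μ T hT i).measurable
  exact hm (measurableSet_singleton w)

lemma finEntropy_backward {m : ℕ} (μ : Measure X) (T : Equiv.Perm X)
    (hT : MeasurePreserving T μ μ) (hTsymm : Measurable (⇑T.symm))
    (ξ : X → Fin m) (hξ : ∀ i, MeasurableSet (ξ ⁻¹' {i})) (n : ℕ) :
    finEntropy μ (fun x => fun i : Fin n => ξ ((T ^ (-(i : ℤ))) x)) =
      finEntropy μ (nName T ξ n) := by
  unfold finEntropy
  refine Fintype.sum_equiv (Equiv.arrowCongr Fin.revPerm (Equiv.refl _)) _ _ fun w => ?_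
  have key : μ ((fun x => fun i : Fin n => ξ ((T ^ (-(i : ℤ))) x)) ⁻¹' {w}) =
      μ (nName T ξ n ⁻¹' {(Equiv.arrowCongr Fin.revPerm (Equiv.refl _)) w}) := by
    have h1 := (mp_pow μ T hT (n - 1)).measure_preimage
      (s := (fun x => fun i : Fin n => ξ ((T ^ (-(i : ℤ))) x)) ⁻¹' {w})
    have h2 : (⇑(T ^ (n - 1))) ⁻¹' ((fun x => fun i : Fin n => ξ ((T ^ (-(i : ℤ))) x)) ⁻¹' {w}) =
        nName T ξ n ⁻¹' {(Equiv.arrowCongr Fin.revPerm (Equiv.refl _)) w} := by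
      have h3 : ∀ (x : X) (i : Fin n), (T ^ (-(i : ℤ))) ((T ^ (n - 1)) x) =
          (T ^ ((Fin.rev i : Fin n) : ℕ)) x := by
        intro x i
        rw [← Equiv.Perm.mul_apply, ← zpow_natCast, ← zpow_natCast, ← zpow_add]
        congr 2
        have := i.2
        rw [Fin.val_rev]
        omega
      ext x
      simp only [mem_preimage, mem_singleton_iff, funext_iff, h3, nName]
      constructor
      · intro h i
        have := h (Fin.rev i)
        simpa using this
      · intro h i
        have := h (Fin.rev i)
        simpa using this
    rw [← h2, h1]
    have hm : Measurable (fun x => fun i : Fin n => ξ ((T ^ (-(i : ℤ))) x)) :=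
      measurable_pi_lambda _ fun i =>
        (measurable_to_countable' hξ).comp (mp_zpow μ T hT hTsymm _).measurable
    exact (hm (measurableSet_singleton w)).nullMeasurableSet
  simp only [key]

/-- The Gibbs inequality. -/
lemma gibbs {ι : Type*} [Fintype ι] (p q : ι → ℝ) (hp : ∀ i, 0 ≤ p i) (hq : ∀ i, 0 < q i)
    (hps : ∑ i, p i = 1) (hqs : ∑ i, q i ≤ 1) :
    ∑ i, -(p i * Real.logb 2 (p i)) ≤ ∑ i, p i * -(Real.logb 2 (q i)) := by
  have h2 : 0 < Real.log 2 := Real.log_pos (by norm_num)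
  have key : ∀ i, -(p i * Real.logb 2 (p i)) ≤
      p i * -(Real.logb 2 (q i)) + (q i - p i) / Real.log 2 := by
    intro i
    rcases (hp i).eq_or_lt with h | h
    · rw [← h]; simp only [zero_mul, neg_zero, sub_zero, zero_add]
      exact div_nonneg (hq i).le h2.le
    · have h3 := Real.log_le_sub_one_of_pos (div_pos (hq i) h)
      rw [Real.log_div (hq i).ne' h.ne'] at h3
      have h4 : p i * (Real.log (q i) - Real.log (p i)) ≤ q i - p i := by
        calc _ ≤ p i * (q i / p i - 1) := mul_le_mul_of_nonneg_left h3 h.le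
          _ = _ := by field_simp
      unfold Real.logb
      rw [← sub_nonneg]
      have : p i * -(Real.log (q i) / Real.log 2) + (q i - p i) / Real.log 2 -
        -(p i * (Real.log (p i) / Real.log 2)) =
        ((q i - p i) - p i * (Real.log (q i) - Real.log (p i))) / Real.log 2 := by
          field_simp; ring
      rw [this]
      exact div_nonneg (by linarith) h2.le
  calc _ ≤ ∑ i, (p i * -(Real.logb 2 (q i)) + (q i - p i) / Real.log 2) :=
        Finset.sum_le_sum fun i _ => key i
    _ = ∑ i, p i * -(Real.logb 2 (q i)) + (∑ i, q i - ∑ i, p i) / Real.log 2 := by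
        rw [Finset.sum_add_distrib, ← Finset.sum_div, Finset.sum_sub_distrib]
    _ ≤ _ := by
        have : (∑ i, q i - ∑ i, p i) / Real.log 2 ≤ 0 :=
          div_nonpos_of_nonpos_of_nonneg (by linarith) h2.le
        linarith

lemma sum_pow_hammingDist {n m : ℕ} (t : ℝ) (c : Fin n → Fin m) :
    ∑ w : Fin n → Fin m, t ^ (hammingDist w c) = (1 + ((m : ℝ) - 1) * t) ^ n := by
  have h1 : ∀ w : Fin n → Fin m, t ^ (hammingDist w c) =
      ∏ i, (if w i = c i then 1 else t) := by
    intro w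
    rw [Finset.prod_ite]
    simp [hammingDist]
  simp only [h1]
  have h2 := Finset.prod_univ_sum (fun _ : Fin n => (Finset.univ : Finset (Fin m)))
    (fun i a => if a = c i then (1 : ℝ) else t)
  rw [Fintype.piFinset_univ] at h2
  rw [← h2]
  have h3 : ∀ i, ∑ a : Fin m, (if a = c i then (1 : ℝ) else t) = 1 + ((m : ℝ) - 1) * t := by
    intro i
    rw [Finset.sum_ite]
    have ha : (Finset.univ.filter (fun a => a = c i)).card = 1 := by
      simp [Finset.filter_eq']
    have hb : (Finset.univ.filter (fun a => ¬ a = c i)).card = m - 1 := by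
      rw [Finset.filter_not, Finset.card_sdiff_of_subset (Finset.filter_subset _ _), ha]; simp
    have hm : 1 ≤ m := by have := (c i).2; omega
    simp [ha, hb, Nat.cast_sub hm]
  simp [h3]

/-- Entropy bound from a Hamming-covering by `K+1` centers. -/
lemma entropy_hamming {n m K : ℕ} (p : (Fin n → Fin m) → ℝ) (hp : ∀ i, 0 ≤ p i)
    (hps : ∑ i, p i = 1) (c : Fin (K + 1) → Fin n → Fin m) (t γ β : ℝ) (ht0 : 0 < t) (ht1 : t < 1)
    (hγ : 0 ≤ γ) (hm : 1 ≤ m)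
    (W : Finset (Fin n → Fin m)) (hW : ∀ w ∈ W, ∃ j, (hammingDist w (c j) : ℝ) ≤ γ * n)
    (hβ : ∑ w ∈ Wᶜ, p w ≤ β) :
    ∑ i, -(p i * Real.logb 2 (p i)) ≤ Real.logb 2 (K + 1) +
      n * Real.logb 2 (1 + ((m : ℝ) - 1) * t) + n * (-Real.logb 2 t) * (γ + β) := by
  set Z := 1 + ((m : ℝ) - 1) * t with hZ
  have hm' : (1 : ℝ) ≤ m := by exact_mod_cast hm
  have hZ1 : 1 ≤ Z := by have : 0 ≤ ((m : ℝ) - 1) * t := mul_nonneg (by linarith) ht0.le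
                         linarith
  have hZ0 : 0 < Z := by linarith
  set L := -Real.logb 2 t with hL
  have hL0 : 0 ≤ L := by
    have := Real.logb_nonpos (b := 2) (by norm_num) ht0.le ht1.le
    linarith
  have hK : (0 : ℝ) < K + 1 := by positivity
  let q : (Fin n → Fin m) → ℝ := fun w => (∑ j, t ^ (hammingDist w (c j))) / ((K + 1) * Z ^ n)
  have hq : ∀ w, 0 < q w := by
    intro w
    refine div_pos (Finset.sum_pos (fun j _ => pow_pos ht0 _) ⟨0, Finset.mem_univ _⟩) (by positivity)
  have hqs : ∑ w, q w ≤ 1 := by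
    simp only [q]
    rw [← Finset.sum_div, Finset.sum_comm]
    simp only [sum_pow_hammingDist]
    rw [← hZ]
    simp only [Finset.sum_const, Finset.card_univ, Fintype.card_fin, nsmul_eq_mul]
    push_cast
    rw [div_self (by positivity)]
  have hlow : ∀ w j (d : ℝ), (hammingDist w (c j) : ℝ) ≤ d →
      -Real.logb 2 (q w) ≤ Real.logb 2 (K + 1) + n * Real.logb 2 Z + L * d := by
    intro w j d hd
    have h1 : t ^ (hammingDist w (c j)) / ((K + 1) * Z ^ n) ≤ q w := by
      simp only [q]
      gcongr
      exact Finset.single_le_sum (f := fun j => t ^ (hammingDist w (c j)))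
        (fun j _ => (pow_pos ht0 _).le) (Finset.mem_univ j)
    have h2 := Real.logb_le_logb_of_le (b := 2) (by norm_num) (by positivity) h1
    rw [Real.logb_div (by positivity) (by positivity), Real.logb_mul (by positivity) (by positivity),
      Real.logb_pow, Real.logb_pow] at h2
    have h3 : L * hammingDist w (c j) ≤ L * d := mul_le_mul_of_nonneg_left hd hL0
    have h4 : (hammingDist w (c j) : ℝ) * Real.logb 2 t = - (L * hammingDist w (c j)) := by
      rw [hL]; ring
    linarith
  refine (gibbs p q hp hq hps hqs).trans ?_
  set A := Real.logb 2 (K + 1) + n * Real.logb 2 Z with hA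
  have hpt : ∀ w, p w * -Real.logb 2 (q w) ≤
      p w * (A + L * (γ * n)) + (if w ∈ Wᶜ then p w else 0) * (L * n) := by
    intro w
    by_cases hw : w ∈ W
    · obtain ⟨j, hj⟩ := hW w hw
      have := hlow w j _ hj
      simp only [Finset.mem_compl, hw, not_true, if_false, zero_mul, add_zero]
      exact mul_le_mul_of_nonneg_left this (hp w)
    · have h1 : (hammingDist w (c 0) : ℝ) ≤ n := by
        have := hammingDist_le_card_fintype (x := w) (y := c 0)
        simp only [Fintype.card_fin] at this
        exact_mod_cast this
      have h2 := hlow w 0 _ h1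
      simp only [Finset.mem_compl, hw, not_false_iff, if_true]
      rw [← mul_add]
      refine mul_le_mul_of_nonneg_left ?_ (hp w)
      have : 0 ≤ L * (γ * n) := by positivity
      linarith
  refine (Finset.sum_le_sum fun w _ => hpt w).trans ?_
  rw [Finset.sum_add_distrib, ← Finset.sum_mul, ← Finset.sum_mul, hps]
  rw [Finset.sum_ite_mem, Finset.univ_inter]
  have : (∑ w ∈ Wᶜ, p w) * (L * n) ≤ β * (L * n) :=
    mul_le_mul_of_nonneg_right hβ (by positivity)
  linarith

/-- A set which is, up to small measure, a union of balls for finitely many shifts of `ρ`. -/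
def GoodSet (μ : Measure X) (T : Equiv.Perm X) (ρ : X → X → ℝ) (A : Set X) : Prop :=
  ∀ δ : ℝ≥0∞, 0 < δ → ∃ N : ℕ, ∃ η : ℝ, 0 < η ∧ ∃ E : Set X, MeasurableSet E ∧ μ E < δ ∧
    ∀ x, x ∉ E → ∀ y, y ∉ E → (∀ k : ℤ, |k| ≤ N → ρ ((T ^ k) x) ((T ^ k) y) < η) →
      (x ∈ A ↔ y ∈ A)

lemma GoodSet.compl {μ : Measure X} {T : Equiv.Perm X} {ρ : X → X → ℝ} {A : Set X}
    (h : GoodSet μ T ρ A) : GoodSet μ T ρ Aᶜ := by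
  intro δ hδ
  obtain ⟨N, η, hη, E, hE, hEδ, hxy⟩ := h δ hδ
  refine ⟨N, η, hη, E, hE, hEδ, fun x hx y hy hk => ?_⟩
  simp only [mem_compl_iff, hxy x hx y hy hk]

/-- Simultaneous witnesses for finitely many good sets. -/
lemma GoodSet.simul {μ : Measure X} {T : Equiv.Perm X} {ρ : X → X → ℝ} {A : ℕ → Set X}
    (h : ∀ i, GoodSet μ T ρ (A i)) (M : ℕ) :
    ∀ δ : ℝ≥0∞, 0 < δ → ∃ N : ℕ, ∃ η : ℝ, 0 < η ∧ ∃ E : Set X, MeasurableSet E ∧ μ E < δ ∧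
    ∀ x, x ∉ E → ∀ y, y ∉ E → (∀ k : ℤ, |k| ≤ N → ρ ((T ^ k) x) ((T ^ k) y) < η) →
      ∀ i < M, (x ∈ A i ↔ y ∈ A i) := by
  induction M with
  | zero =>
    intro δ hδ
    exact ⟨0, 1, one_pos, ∅, MeasurableSet.empty, by simpa using hδ, fun _ _ _ _ _ i hi => by omega⟩
  | succ M ih =>
    intro δ hδ
    have hδ2 : 0 < δ / 2 := ENNReal.half_pos hδ.ne'
    obtain ⟨N, η, hη, E, hE, hEδ, hxy⟩ := ih _ hδ2
    obtain ⟨N', η', hη', E', hE', hEδ', hxy'⟩ := h M _ hδ2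
    refine ⟨max N N', min η η', lt_min hη hη', E ∪ E', hE.union hE', ?_, ?_⟩
    · calc μ (E ∪ E') ≤ μ E + μ E' := measure_union_le _ _
        _ < δ / 2 + δ / 2 := ENNReal.add_lt_add hEδ hEδ'
        _ = δ := ENNReal.add_halves δ
    · intro x hx y hy hk i hi
      simp only [mem_union, not_or] at hx hy
      rcases Nat.lt_succ_iff_lt_or_eq.1 hi with hi | rfl
      · exact hxy x hx.1 y hy.1 (fun k hkN => (hk k (hkN.trans (by simp))).trans_le
          (min_le_left _ _)) i hi
      · exact hxy' x hx.2 y hy.2 (fun k hkN => (hk k (hkN.trans (by simp))).trans_le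
          (min_le_right _ _))

lemma GoodSet.iUnion {μ : Measure X} [IsProbabilityMeasure μ] {T : Equiv.Perm X}
    {ρ : X → X → ℝ} {A : ℕ → Set X} (hA : ∀ i, MeasurableSet (A i))
    (h : ∀ i, GoodSet μ T ρ (A i)) : GoodSet μ T ρ (⋃ i, A i) := by
  intro δ hδ
  have hδ2 : 0 < δ / 2 := ENNReal.half_pos hδ.ne'
  let S : ℕ → Set X := fun M => (⋃ i, A i) \ ⋃ i, ⋃ (_ : i < M), A i
  have hS : ∀ M, MeasurableSet (S M) := fun M =>
    (MeasurableSet.iUnion hA).diff (MeasurableSet.iUnion fun i => MeasurableSet.iUnion fun _ => hA i)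
  have hanti : Antitone S := by
    intro M M' hM x hx
    refine ⟨hx.1, fun hx' => hx.2 ?_⟩
    simp only [mem_iUnion] at hx' ⊢
    obtain ⟨i, hi, hxi⟩ := hx'
    exact ⟨i, by omega, hxi⟩
  have hemp : ⋂ M, S M = ∅ := by
    ext x
    simp only [mem_iInter, mem_empty_iff_false, iff_false, not_forall]
    by_cases hx : x ∈ ⋃ i, A i
    · obtain ⟨i, hi⟩ := mem_iUnion.1 hx
      refine ⟨i + 1, fun h => h.2 ?_⟩
      simp only [mem_iUnion]
      exact ⟨i, by omega, hi⟩
    · exact ⟨0, fun h => hx h.1⟩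
  have ht := tendsto_measure_iInter_atTop (μ := μ) (fun i => (hS i).nullMeasurableSet) hanti
    ⟨0, measure_ne_top _ _⟩
  rw [hemp, measure_empty] at ht
  obtain ⟨M, hM⟩ := (ht.eventually (gt_mem_nhds hδ2)).exists
  obtain ⟨N, η, hη, E, hE, hEδ, hxy⟩ := GoodSet.simul h M _ hδ2
  refine ⟨N, η, hη, E ∪ S M, hE.union (hS M), ?_, ?_⟩
  · calc μ (E ∪ S M) ≤ μ E + μ (S M) := measure_union_le _ _
      _ < δ / 2 + δ / 2 := ENNReal.add_lt_add hEδ hM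
      _ = δ := ENNReal.add_halves δ
  · intro x hx y hy hk
    simp only [mem_union, not_or] at hx hy
    have h1 := hxy x hx.1 y hy.1 hk
    have h2 : ∀ z, z ∉ S M → (z ∈ ⋃ i, A i ↔ ∃ i < M, z ∈ A i) := by
      intro z hz
      constructor
      · intro hzA
        by_contra hcon
        refine hz ⟨hzA, fun h => hcon ?_⟩
        simpa only [mem_iUnion, exists_prop] using h
      · rintro ⟨i, _, hi⟩
        exact mem_iUnion.2 ⟨i, hi⟩
    rw [h2 x hx.2, h2 y hy.2]
    constructor
    · rintro ⟨i, hi, hxi⟩; exact ⟨i, hi, (h1 i hi).1 hxi⟩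
    · rintro ⟨i, hi, hxi⟩; exact ⟨i, hi, (h1 i hi).2 hxi⟩

/-- The σ-algebra of measurable good sets. -/
def goodMS (μ : Measure X) [IsProbabilityMeasure μ] (T : Equiv.Perm X) (ρ : X → X → ℝ) :
    MeasurableSpace X where
  MeasurableSet' A := MeasurableSet A ∧ GoodSet μ T ρ A
  measurableSet_empty := ⟨MeasurableSet.empty, fun δ hδ => ⟨0, 1, one_pos, ∅, MeasurableSet.empty,
    by simpa using hδ, fun _ _ _ _ _ => by simp⟩⟩
  measurableSet_compl _ h := ⟨h.1.compl, h.2.compl⟩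
  measurableSet_iUnion _ h := ⟨MeasurableSet.iUnion fun i => (h i).1,
    GoodSet.iUnion (fun i => (h i).1) fun i => (h i).2⟩

lemma goodMS_coord (μ : Measure X) [IsProbabilityMeasure μ] (T : Equiv.Perm X)
    (hT : MeasurePreserving T μ μ) (hTsymm : Measurable (⇑T.symm))
    (ρ : X → X → ℝ) (hρ : IsSemimetric ρ) (hρm : Measurable (fun p : X × X => ρ p.1 p.2))
    (k : ℤ) (y : X) : Measurable[goodMS μ T ρ] (fun x => ρ ((T ^ k) x) y) := by
  have hu : Measurable (fun x => ρ ((T ^ k) x) y) :=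
    hρm.comp ((mp_zpow μ T hT hTsymm k).measurable.prodMk measurable_const)
  refine @measurable_of_Iio ℝ X _ _ _ (goodMS μ T ρ) _ _ _ _ fun r => ?_
  refine ⟨hu measurableSet_Iio, fun δ hδ => ?_⟩
  set u := fun x => ρ ((T ^ k) x) y with hu_def
  let S : ℕ → Set X := fun l => u ⁻¹' (Ico (r - 1 / ((l : ℝ) + 1)) r)
  have hS : ∀ l, MeasurableSet (S l) := fun l => hu measurableSet_Ico
  have hanti : Antitone S := by
    intro a b hab
    refine preimage_mono (Ico_subset_Ico_left ?_)
    have := one_div_le_one_div_of_le (by positivity : (0 : ℝ) < (a : ℝ) + 1)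
      (by have : (a : ℝ) ≤ b := by exact_mod_cast hab
          linarith : (a : ℝ) + 1 ≤ (b : ℝ) + 1)
    linarith
  have hemp : ⋂ l, S l = ∅ := by
    ext x
    simp only [mem_iInter, mem_empty_iff_false, iff_false, not_forall]
    by_cases hx : u x < r
    · obtain ⟨l, hl⟩ := exists_nat_one_div_lt (sub_pos.2 hx)
      refine ⟨l, fun h => ?_⟩
      have := h.1
      linarith
    · exact ⟨0, fun h => hx h.2⟩
  have ht := tendsto_measure_iInter_atTop (μ := μ) (fun i => (hS i).nullMeasurableSet) hanti
    ⟨0, measure_ne_top _ _⟩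
  rw [hemp, measure_empty] at ht
  obtain ⟨l, hl⟩ := (ht.eventually (gt_mem_nhds hδ)).exists
  refine ⟨k.natAbs, 1 / ((l : ℝ) + 1), by positivity, S l, hS l, hl, fun x hx z hz hk => ?_⟩
  have hk' := hk k (by simp)
  have aux : ∀ x z, x ∉ S l → ρ ((T ^ k) z) ((T ^ k) x) < 1 / ((l : ℝ) + 1) → u x < r → u z < r := by
    intro x z hx h1 h2
    have h3 : u x < r - 1 / ((l : ℝ) + 1) := by
      by_contra hcon
      exact hx ⟨not_lt.1 hcon, h2⟩
    have h4 : u z ≤ ρ ((T ^ k) z) ((T ^ k) x) + u x := hρ.triangle _ _ _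
    linarith
  constructor
  · exact aux x z hx (by rw [hρ.symm]; exact hk')
  · exact aux z x hz hk'

/-- If `ρ` is admissible and generating, all measurable sets are good. -/
lemma goodSet_of_measurable [StandardBorelSpace X] (μ : Measure X) [IsProbabilityMeasure μ]
    (T : Equiv.Perm X)
    (hT : MeasurePreserving T μ μ) (hTsymm : Measurable (⇑T.symm))
    (ρ : X → X → ℝ) (hρ : IsSemimetric ρ) (hρm : Measurable (fun p : X × X => ρ p.1 p.2))
    (hadm : IsAdmissible μ ρ) (hgen : IsGenerating μ T ρ) (A : Set X) (hA : MeasurableSet A) :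
    GoodSet μ T ρ A := by
  obtain ⟨s2, hs2, hs2μ, D, hD, hDs, hdense⟩ := hadm
  obtain ⟨s1, hs1, hs1μ, hsep⟩ := hgen
  have hne : s2.Nonempty := by
    by_contra hcon
    rw [not_nonempty_iff_eq_empty] at hcon
    simp [hcon] at hs2μ
  have hDne : D.Nonempty := by
    obtain ⟨x, hx⟩ := hne
    obtain ⟨y, hy, _⟩ := hdense x hx 1 one_pos
    exact ⟨y, hy⟩
  obtain ⟨y, hy⟩ := hD.exists_eq_range hDne
  let s : Set X := s1 ∩ ⋂ k : ℤ, (⇑(T ^ k)) ⁻¹' s2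
  have hs : MeasurableSet s := hs1.inter
    (MeasurableSet.iInter fun k => (mp_zpow μ T hT hTsymm k).measurable hs2)
  have hsμ : μ sᶜ = 0 := by
    rw [compl_inter, measure_union_null_iff]
    refine ⟨hs1μ, ?_⟩
    rw [compl_iInter, measure_iUnion_null_iff]
    intro k
    rw [← preimage_compl, (mp_zpow μ T hT hTsymm k).measure_preimage hs2.compl.nullMeasurableSet]
    exact hs2μ
  let f : X → (ℤ × ℕ → ℝ) := fun x q => ρ ((T ^ q.1) x) (y q.2)
  have hfg : Measurable[goodMS μ T ρ] f :=
    @measurable_pi_lambda X (ℤ × ℕ) (fun _ => ℝ) (goodMS μ T ρ) _ f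
      fun q => goodMS_coord μ T hT hTsymm ρ hρ hρm q.1 (y q.2)
  have hfm : Measurable f := fun B hB => (hfg hB).1
  have : StandardBorelSpace s := hs.standardBorel
  let g : s → (ℤ × ℕ → ℝ) := fun x => f x
  have hg : Measurable g := hfm.comp measurable_subtype_coe
  have hinj : Function.Injective g := by
    rintro ⟨a, ha⟩ ⟨b, hb⟩ hab
    by_contra hcon
    have hne : a ≠ b := fun h => hcon (by simp [h])
    obtain ⟨k, hk⟩ := hsep a ha.1 b hb.1 hne
    have hak : (T ^ k) a ∈ s2 := mem_iInter.1 ha.2 k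
    obtain ⟨z, hz, hzlt⟩ := hdense _ hak _ (half_pos hk)
    rw [hy] at hz
    obtain ⟨j, rfl⟩ := hz
    have h1 : ρ ((T ^ k) a) (y j) = ρ ((T ^ k) b) (y j) := congrFun hab (k, j)
    have h2 := hρ.triangle ((T ^ k) a) (y j) ((T ^ k) b)
    rw [hρ.symm (y j)] at h2
    linarith
  have hemb := hg.measurableEmbedding hinj
  have hB : MeasurableSet (g '' (Subtype.val ⁻¹' A)) :=
    hemb.measurableSet_image.2 (measurable_subtype_coe hA)
  have hgood : GoodSet μ T ρ (f ⁻¹' (g '' (Subtype.val ⁻¹' A))) := (hfg hB).2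
  have heq : ∀ x ∈ s, (x ∈ f ⁻¹' (g '' (Subtype.val ⁻¹' A)) ↔ x ∈ A) := by
    intro x hx
    constructor
    · rintro ⟨z, hz, hzx⟩
      have : z = ⟨x, hx⟩ := hinj hzx
      rw [this] at hz
      exact hz
    · intro hxA
      exact ⟨⟨x, hx⟩, hxA, rfl⟩
  intro δ hδ
  obtain ⟨N, η, hη, E, hE, hEδ, hxy⟩ := hgood δ hδ
  refine ⟨N, η, hη, E ∪ sᶜ, hE.union hs.compl, ?_, ?_⟩
  · refine (measure_union_le _ _).trans_lt ?_
    rw [hsμ, add_zero]; exact hEδ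
  · intro x hx z hz hk
    simp only [mem_union, not_or, mem_compl_iff, not_not] at hx hz
    rw [← heq x hx.2, ← heq z hz.2]
    exact hxy x hx.1 z hz.1 hk

lemma good_partition [StandardBorelSpace X] (μ : Measure X) [IsProbabilityMeasure μ]
    (T : Equiv.Perm X)
    (hT : MeasurePreserving T μ μ) (hTsymm : Measurable (⇑T.symm))
    (ρ : X → X → ℝ) (hρ : IsSemimetric ρ) (hρm : Measurable (fun p : X × X => ρ p.1 p.2))
    (hadm : IsAdmissible μ ρ) (hgen : IsGenerating μ T ρ) {m : ℕ} (ξ : X → Fin m)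
    (hξ : ∀ i, MeasurableSet (ξ ⁻¹' {i})) (δ : ℝ≥0∞) (hδ : 0 < δ) :
    ∃ N : ℕ, ∃ η : ℝ, 0 < η ∧ ∃ E : Set X, MeasurableSet E ∧ μ E < δ ∧
    ∀ x, x ∉ E → ∀ y, y ∉ E → (∀ k : ℤ, |k| ≤ N → ρ ((T ^ k) x) ((T ^ k) y) < η) → ξ x = ξ y := by
  have hm : Measurable ξ := measurable_to_countable' hξ
  obtain ⟨N, η, hη, E, hE, hEδ, hxy⟩ := GoodSet.simul (μ := μ) (T := T) (ρ := ρ)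
    (A := fun i => ξ ⁻¹' {j | (j : ℕ) = i})
    (fun i => goodSet_of_measurable μ T hT hTsymm ρ hρ hρm hadm hgen _
      (hm (Set.toFinite _).measurableSet)) m δ hδ
  refine ⟨N, η, hη, E, hE, hEδ, fun x hx y hy hk => ?_⟩
  have := (hxy x hx y hy hk (ξ x) (ξ x).2).1 rfl
  exact Fin.ext (Eq.symm this)

/-- The Markov inequality for ergodic averages. -/
lemma markov_avg (μ : Measure X) [IsProbabilityMeasure μ] (T : Equiv.Perm X)
    (hT : MeasurePreserving T μ μ) (g : X → ℝ) (hg0 : ∀ x, 0 ≤ g x) (hg : Integrable g μ)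
    (n : ℕ) (hn : 1 ≤ n) (a : ℝ) :
    a * μ.real {x | a ≤ (∑ i ∈ Finset.range n, g ((T ^ i) x)) / n} ≤ ∫ x, g x ∂μ := by
  have hn' : (0 : ℝ) < n := by exact_mod_cast hn
  have hint : ∀ i ∈ Finset.range n, Integrable (fun x => g ((T ^ i) x)) μ := fun i _ =>
    (mp_pow μ T hT i).integrable_comp_of_integrable hg
  have h1 := mul_meas_ge_le_integral_of_nonneg (μ := μ)
    (f := fun x => (∑ i ∈ Finset.range n, g ((T ^ i) x)) / n)
    (Eventually.of_forall fun x => div_nonneg (Finset.sum_nonneg fun i _ => hg0 _) hn'.le)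
    ((integrable_finsetSum _ hint).div_const _) a
  refine h1.trans (le_of_eq ?_)
  rw [integral_div, integral_finsetSum _ hint]
  have h2 : ∀ i ∈ Finset.range n, ∫ x, g ((T ^ i) x) ∂μ = ∫ x, g x ∂μ := by
    intro i _
    have hmp := mp_pow μ T hT i
    have hgm : AEStronglyMeasurable g (μ.map (⇑(T ^ i))) := by
      rw [hmp.map_eq]; exact hg.aestronglyMeasurable
    rw [← integral_map hmp.measurable.aemeasurable hgm, hmp.map_eq]
  rw [Finset.sum_congr rfl h2]
  simp only [Finset.sum_const, Finset.card_range, nsmul_eq_mul]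
  field_simp

open scoped Classical in
lemma hamming_names {ι : Type*} (T : Equiv.Perm X) (ρ : X → X → ℝ) (hρ : IsSemimetric ρ)
    (ξ : X → ι) (N : ℕ) (η : ℝ) (hη : 0 < η) (E : Set X)
    (hE : ∀ x, x ∉ E → ∀ y, y ∉ E →
      (∀ k : ℤ, |k| ≤ N → ρ ((T ^ k) x) ((T ^ k) y) < η) → ξ x = ξ y)
    (n : ℕ) (hn : 1 ≤ n) (ε κ : ℝ) (hκ : 0 < κ) (hε : (2 * N + 1) * ε ≤ κ * η)
    (hNn : 2 * (N : ℝ) ≤ κ * n) (x y : X)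
    (hxE : (((Finset.range n).filter (fun i => (T ^ i) x ∈ E)).card : ℝ) ≤ κ * n)
    (hyE : (((Finset.range n).filter (fun i => (T ^ i) y ∈ E)).card : ℝ) ≤ κ * n)
    (hxy : avgSemimetric T ρ n x y < ε) :
    (hammingDist (nName T ξ n x) (nName T ξ n y) : ℝ) ≤ 4 * κ * n := by
  have hn' : (0 : ℝ) < n := by exact_mod_cast hn
  set Bx := (Finset.range n).filter (fun i => (T ^ i) x ∈ E)
  set By := (Finset.range n).filter (fun i => (T ^ i) y ∈ E)
  set Bad := (Finset.range n).filter (fun i => η ≤ ρ ((T ^ i) x) ((T ^ i) y)) with hBad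
  let Sh := (Finset.Icc (-(N : ℤ)) N).biUnion
    (fun k => Bad.image (fun l : ℕ => ((l : ℤ) - k).toNat))
  -- bound on the number of bad indices
  have hBadcard : (Bad.card : ℝ) * η ≤ ε * n := by
    have h1 : (Bad.card : ℝ) * η ≤ ∑ i ∈ Bad, ρ ((T ^ i) x) ((T ^ i) y) := by
      rw [← nsmul_eq_mul]
      exact Finset.card_nsmul_le_sum _ _ _ fun i hi => (Finset.mem_filter.1 hi).2
    have h2 : ∑ i ∈ Bad, ρ ((T ^ i) x) ((T ^ i) y) ≤
        ∑ i ∈ Finset.range n, ρ ((T ^ i) x) ((T ^ i) y) :=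
      Finset.sum_le_sum_of_subset_of_nonneg (Finset.filter_subset _ _)
        fun i _ _ => hρ.nonneg _ _
    unfold avgSemimetric at hxy
    rw [div_lt_iff₀ hn'] at hxy
    linarith
  have hShcard : (Sh.card : ℝ) ≤ (2 * N + 1) * Bad.card := by
    have h1 : Sh.card ≤ ∑ k ∈ Finset.Icc (-(N : ℤ)) N, Bad.card :=
      Finset.card_biUnion_le.trans (Finset.sum_le_sum fun k _ => Finset.card_image_le)
    rw [Finset.sum_const, Int.card_Icc, smul_eq_mul] at h1
    have h2 : ((N : ℤ) + 1 - -(N : ℤ)).toNat = 2 * N + 1 := by omega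
    rw [h2] at h1
    exact_mod_cast h1
  have hsub : (Finset.univ.filter (fun i : Fin n => nName T ξ n x i ≠ nName T ξ n y i)).image
      (fun i : Fin n => (i : ℕ)) ⊆
      (Bx ∪ By) ∪ ((Finset.range N ∪ Finset.Ico (n - N) n) ∪ Sh) := by
    intro i hi
    obtain ⟨j, hj, rfl⟩ := Finset.mem_image.1 hi
    have hj' := (Finset.mem_filter.1 hj).2
    by_contra hcon
    simp only [Finset.mem_union, not_or] at hcon
    obtain ⟨⟨hx, hy⟩, ⟨hN1, hN2⟩, hSh⟩ := hcon
    have hjn : (j : ℕ) ∈ Finset.range n := Finset.mem_range.2 j.2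
    have hx' : (T ^ (j : ℕ)) x ∉ E := fun h => hx (Finset.mem_filter.2 ⟨hjn, h⟩)
    have hy' : (T ^ (j : ℕ)) y ∉ E := fun h => hy (Finset.mem_filter.2 ⟨hjn, h⟩)
    refine hj' (hE _ hx' _ hy' fun k hk => ?_)
    by_contra hlt
    rw [not_lt] at hlt
    refine hSh ?_
    have hjN : N ≤ (j : ℕ) := by simpa using hN1
    have hjN2 : (j : ℕ) + N < n := by
      have := j.2
      simp only [Finset.mem_Ico, not_and, not_lt] at hN2
      by_contra h
      have := hN2 (by omega)
      omega
    have hk' := abs_le.1 hk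
    have hcast : ((((j : ℕ) : ℤ) + k).toNat : ℤ) = (j : ℕ) + k := Int.toNat_of_nonneg (by omega)
    have hz : ∀ z : X, (T ^ k) ((T ^ (j : ℕ)) z) = (T ^ ((((j : ℕ) : ℤ) + k).toNat)) z := by
      intro z
      rw [← Equiv.Perm.mul_apply, ← zpow_natCast T (j : ℕ), ← zpow_natCast T (Int.toNat _), hcast,
        ← zpow_add, add_comm]
    rw [hz, hz] at hlt
    refine Finset.mem_biUnion.2 ⟨k, Finset.mem_Icc.2 hk', Finset.mem_image.2
      ⟨(((j : ℕ) : ℤ) + k).toNat, Finset.mem_filter.2 ⟨Finset.mem_range.2 (by omega), hlt⟩, ?_⟩⟩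
    rw [hcast]; omega
  have hcard : hammingDist (nName T ξ n x) (nName T ξ n y) ≤
      (Bx.card + By.card) + ((N + N) + Sh.card) := by
    have h1 : hammingDist (nName T ξ n x) (nName T ξ n y) =
        ((Finset.univ.filter (fun i : Fin n => nName T ξ n x i ≠ nName T ξ n y i)).image
          (fun i : Fin n => (i : ℕ))).card := by
      rw [Finset.card_image_of_injective _ Fin.val_injective]
      rfl
    rw [h1]
    refine (Finset.card_le_card hsub).trans ?_
    refine (Finset.card_union_le _ _).trans (add_le_add (Finset.card_union_le _ _) ?_)
    refine (Finset.card_union_le _ _).trans (add_le_add_left ?_ _)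
    refine (Finset.card_union_le _ _).trans (add_le_add (by simp) ?_)
    simp only [Nat.card_Ico]; omega
  have hcardR : (hammingDist (nName T ξ n x) (nName T ξ n y) : ℝ) ≤
      (Bx.card + By.card) + ((N + N) + Sh.card) := by exact_mod_cast hcard
  have hShle : (Sh.card : ℝ) ≤ κ * n := by
    have h3 : (Sh.card : ℝ) * η ≤ (κ * n) * η := by
      calc (Sh.card : ℝ) * η ≤ ((2 * N + 1) * Bad.card) * η := by gcongr
        _ = (2 * N + 1) * (Bad.card * η) := by ring
        _ ≤ (2 * N + 1) * (ε * n) := by gcongr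
        _ = ((2 * N + 1) * ε) * n := by ring
        _ ≤ (κ * η) * n := by gcongr
        _ = _ := by ring
    exact le_of_mul_le_mul_right h3 hη
  linarith

open scoped Classical in
lemma entropy_bound (μ : Measure X) [IsProbabilityMeasure μ] (T : Equiv.Perm X)
    (hT : MeasurePreserving T μ μ) (ρ : X → X → ℝ) (hρ : IsSemimetric ρ)
    {m : ℕ} (ξ : X → Fin m) (hξ : ∀ i, MeasurableSet (ξ ⁻¹' {i}))
    (N : ℕ) (η : ℝ) (hη : 0 < η) (E : Set X) (hEm : MeasurableSet E)
    (hE : ∀ x, x ∉ E → ∀ y, y ∉ E →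
      (∀ k : ℤ, |k| ≤ N → ρ ((T ^ k) x) ((T ^ k) y) < η) → ξ x = ξ y)
    (n : ℕ) (hn : 1 ≤ n) (ε κ : ℝ) (hκ : 0 < κ) (hε : (2 * N + 1) * ε ≤ κ * η) (hεκ : ε ≤ κ)
    (hμE : μ E < ENNReal.ofReal (κ * κ))
    (hNn : 2 * (N : ℝ) ≤ κ * n) (K : ℕ) (hP : IsEntropyPartition μ (avgSemimetric T ρ n) ε K)
    (t : ℝ) (ht0 : 0 < t) (ht1 : t < 1) :
    finEntropy μ (nName T ξ n) ≤ Real.logb 2 (K + 1) +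
      n * Real.logb 2 (1 + ((m : ℝ) - 1) * t) + n * (-Real.logb 2 t) * (4 * κ + 2 * κ) := by
  have hn' : (0 : ℝ) < n := by exact_mod_cast hn
  obtain ⟨P, hPm, -, hPu, hP0, hPd⟩ := hP
  let g : X → ℝ := E.indicator 1
  let G : Set X := {x | κ ≤ (∑ i ∈ Finset.range n, g ((T ^ i) x)) / n}
  have hgc : ∀ x, ∑ i ∈ Finset.range n, g ((T ^ i) x) =
      (((Finset.range n).filter (fun i => (T ^ i) x ∈ E)).card : ℝ) := by
    intro x
    simp only [g, indicator_apply, Pi.one_apply]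
    rw [Finset.sum_ite]
    simp
  have hGμ : μ.real G ≤ κ := by
    have h1 := markov_avg μ T hT g (fun x => indicator_nonneg (fun _ _ => zero_le_one) x)
      ((integrable_const 1).indicator hEm) n hn κ
    have h2 : ∫ x, g x ∂μ = μ.real E := integral_indicator_one hEm
    have h3 : μ.real E ≤ κ * κ := ENNReal.toReal_le_of_le_ofReal (by positivity) hμE.le
    rw [h2] at h1
    exact le_of_mul_le_mul_left (h1.trans h3) hκ
  have hnG : ∀ x, x ∉ G → (((Finset.range n).filter (fun i => (T ^ i) x ∈ E)).card : ℝ) ≤ κ * n := by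
    intro x hx
    simp only [G, mem_ofPred_eq, not_le, hgc, div_lt_iff₀ hn'] at hx
    exact hx.le
  have hne : Nonempty X := nonempty_of_isProbabilityMeasure μ
  have hm1 : 1 ≤ m := by
    obtain ⟨x⟩ := hne
    have := (ξ x).2
    omega
  have hc : ∀ j, ∃ z : X, (P j \ G).Nonempty → z ∈ P j \ G := by
    intro j
    by_cases h : (P j \ G).Nonempty
    · obtain ⟨z, hz⟩ := h
      exact ⟨z, fun _ => hz⟩
    · exact ⟨hne.some, fun h' => absurd h' h⟩
  choose z hz using hc
  let W : Finset (Fin n → Fin m) := Finset.univ.filter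
    (fun w => ∃ j, (hammingDist w (nName T ξ n (z j)) : ℝ) ≤ 4 * κ * n)
  have hmeas := measurableSet_nName μ T hT ξ hξ n
  have hsum : ∀ V : Finset (Fin n → Fin m), ∑ w ∈ V, (μ (nName T ξ n ⁻¹' {w})).toReal =
      μ.real (nName T ξ n ⁻¹' V) := fun V =>
    sum_measureReal_preimage_singleton V (fun w _ => hmeas w)
  refine entropy_hamming (fun w => (μ (nName T ξ n ⁻¹' {w})).toReal)
    (fun _ => ENNReal.toReal_nonneg) ?_ (fun j => nName T ξ n (z j)) t (4 * κ) (2 * κ) ht0 ht1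
    (by positivity) hm1 W (fun w hw => (Finset.mem_filter.1 hw).2) ?_
  · rw [hsum]; simp
  · rw [hsum]
    have hsub : nName T ξ n ⁻¹' ((Wᶜ : Finset (Fin n → Fin m)) : Set (Fin n → Fin m)) ⊆ P 0 ∪ G := by
      intro x hx
      by_contra hcon
      simp only [mem_union, not_or] at hcon
      obtain ⟨j, hj⟩ := mem_iUnion.1 (hPu.symm ▸ mem_univ x : x ∈ ⋃ j, P j)
      have hj0 : j ≠ 0 := by
        rintro rfl
        exact hcon.1 hj
      have hzj := hz j ⟨x, hj, hcon.2⟩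
      have := hamming_names T ρ hρ ξ N η hη E hE n hn ε κ hκ hε hNn x (z j) (hnG x hcon.2)
        (hnG _ hzj.2) (hPd j hj0 x hj _ hzj.1)
      simp only [mem_preimage, Finset.coe_compl, mem_compl_iff, Finset.mem_coe] at hx
      refine hx (Finset.mem_filter.2 ⟨Finset.mem_univ _, j, ?_⟩)
      convert this
    have h0 : μ.real (P 0) ≤ κ := by
      refine (ENNReal.toReal_le_of_le_ofReal hκ.le (hP0.le.trans (ENNReal.ofReal_le_ofReal hεκ)))
    calc _ ≤ μ.real (P 0 ∪ G) := measureReal_mono hsub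
      _ ≤ μ.real (P 0) + μ.real G := measureReal_union_le _ _
      _ ≤ 2 * κ := by linarith

lemma entropy_small [StandardBorelSpace X] (μ : Measure X) [IsProbabilityMeasure μ]
    (T : Equiv.Perm X)
    (hT : MeasurePreserving T μ μ) (hTsymm : Measurable (⇑T.symm))
    (ρ : X → X → ℝ) (hρ : IsSemimetric ρ) (hρm : Measurable (fun p : X × X => ρ p.1 p.2))
    (hadm : IsAdmissible μ ρ) (hgen : IsGenerating μ T ρ)
    (hsmall : ∀ ε : ℝ, 0 < ε → ∀ θ : ℝ, 0 < θ → ∀ᶠ n : ℕ in atTop,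
      ∃ K, IsEntropyPartition μ (avgSemimetric T ρ n) ε K ∧ Real.logb 2 K ≤ θ * n)
    {m : ℕ} (ξ : X → Fin m)
    (hξ : ∀ i, MeasurableSet (ξ ⁻¹' {i})) (θ : ℝ) (hθ : 0 < θ) :
    ∀ᶠ n : ℕ in atTop, finEntropy μ (nName T ξ n) ≤ θ * n := by
  -- choose `t`
  have htt : ∃ t : ℝ, 0 < t ∧ t < 1 ∧ Real.logb 2 (1 + ((m : ℝ) - 1) * t) < θ / 4 := by
    have hcont : ContinuousAt (fun t : ℝ => Real.logb 2 (1 + ((m : ℝ) - 1) * t)) 0 := by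
      unfold Real.logb
      refine ContinuousAt.div_const (ContinuousAt.log (by fun_prop) (by simp)) _
    have h1 : ∀ᶠ t in nhds (0 : ℝ), Real.logb 2 (1 + ((m : ℝ) - 1) * t) < θ / 4 := by
      refine hcont.eventually (gt_mem_nhds ?_)
      simp; linarith
    have h2 : ∀ᶠ t in nhdsWithin (0 : ℝ) (Ioi 0), t ∈ Ioo (0 : ℝ) 1 := Ioo_mem_nhdsGT one_pos
    obtain ⟨t, ht, ht'⟩ := ((h1.filter_mono nhdsWithin_le_nhds).and h2).exists
    exact ⟨t, ht'.1, ht'.2, ht⟩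
  obtain ⟨t, ht0, ht1, htlog⟩ := htt
  set L := -Real.logb 2 t with hL
  have hL0 : 0 ≤ L := by
    have := Real.logb_nonpos (b := 2) (by norm_num) ht0.le ht1.le
    linarith
  let κ : ℝ := θ / (24 * (L + 1))
  have hκ : 0 < κ := by positivity
  have hκL : L * (4 * κ + 2 * κ) ≤ θ / 4 := by
    have h1 : κ * (24 * (L + 1)) = θ := by
      simp only [κ]; field_simp
    nlinarith
  obtain ⟨N, η, hη, E, hEm, hEμ, hE⟩ := good_partition μ T hT hTsymm ρ hρ hρm hadm hgen ξ hξ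
    (ENNReal.ofReal (κ * κ)) (by simp; positivity)
  let ε : ℝ := min κ (κ * η / (2 * N + 1))
  have hε : 0 < ε := lt_min hκ (by positivity)
  have hε1 : (2 * N + 1) * ε ≤ κ * η := by
    have h1 : ε ≤ κ * η / (2 * N + 1) := min_le_right _ _
    rw [le_div_iff₀ (by positivity)] at h1
    linarith
  have hbig : ∀ c : ℝ, ∀ᶠ n : ℕ in atTop, c ≤ n := fun c =>
    tendsto_natCast_atTop_atTop.eventually (eventually_ge_atTop c)
  filter_upwards [hsmall ε hε (θ / 4) (by positivity), hbig 1, hbig (2 * N / κ),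
    hbig (1 / (θ / 4))] with n hK hn1 hn2 hn3
  obtain ⟨K, hP, hKlog⟩ := hK
  have hn1' : 1 ≤ n := by exact_mod_cast hn1
  rw [div_le_iff₀ hκ] at hn2
  rw [div_le_iff₀ (by positivity)] at hn3
  have key := entropy_bound μ T hT ρ hρ ξ hξ N η hη E hEm hE n hn1' ε κ hκ hε1 (min_le_left _ _)
    hEμ (by linarith) K hP t ht0 ht1
  have hK1 : Real.logb 2 (K + 1) ≤ Real.logb 2 K + 1 := by
    rcases Nat.eq_zero_or_pos K with rfl | hKpos
    · simp
    · have hKr : (1 : ℝ) ≤ K := by exact_mod_cast hKpos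
      have h1 : Real.logb 2 K + 1 = Real.logb 2 (K * 2) := by
        rw [Real.logb_mul (by positivity) (by norm_num), Real.logb_self_eq_one (by norm_num)]
      rw [h1]
      exact Real.logb_le_logb_of_le (by norm_num) (by positivity) (by linarith)
  have h5 : (n : ℝ) * Real.logb 2 (1 + ((m : ℝ) - 1) * t) ≤ n * (θ / 4) := by gcongr
  have h6 : (n : ℝ) * L * (4 * κ + 2 * κ) ≤ n * (θ / 4) := by
    rw [mul_assoc]; gcongr
  linarith

lemma mkPartition {ι : Type*} (μ : Measure X) (ρ : X → X → ℝ) (ε : ℝ) (f : X → ι)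
    (hf : ∀ i, MeasurableSet (f ⁻¹' {i})) (V : Finset ι) (B : Set X) (hB : MeasurableSet B)
    (hμ : μ (B ∪ (f ⁻¹' (V : Set ι))ᶜ) < ENNReal.ofReal ε)
    (hd : ∀ x, x ∉ B → ∀ y, y ∉ B → f x = f y → ρ x y < ε) :
    IsEntropyPartition μ ρ ε V.card := by
  have hV : MeasurableSet (f ⁻¹' (V : Set ι)) := by
    have : f ⁻¹' (V : Set ι) = ⋃ i ∈ V, f ⁻¹' {i} := by ext x; simp
    rw [this]
    exact Finset.measurableSet_biUnion _ fun i _ => hf i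
  refine ⟨Fin.cons (B ∪ (f ⁻¹' (V : Set ι))ᶜ)
    (fun j : Fin V.card => f ⁻¹' {((V.equivFin.symm j) : ι)} \ B), ?_, ?_, ?_, ?_, ?_⟩
  · intro j
    refine Fin.cases ?_ (fun j => ?_) j
    · simpa using hB.union hV.compl
    · simpa using (hf _).diff hB
  · have key : ∀ j : Fin V.card, Disjoint (B ∪ (f ⁻¹' (V : Set ι))ᶜ)
        (f ⁻¹' {((V.equivFin.symm j) : ι)} \ B) := by
      intro j
      rw [Set.disjoint_left]
      rintro x (hx | hx) hx'
      · exact hx'.2 hx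
      · refine hx ?_
        have h1 : f x = (V.equivFin.symm j : ι) := hx'.1
        show f x ∈ (V : Set ι)
        rw [h1]
        exact (V.equivFin.symm j).2
    intro i j hij
    induction i using Fin.cases with
    | zero =>
      induction j using Fin.cases with
      | zero => exact absurd rfl hij
      | succ j => simpa using key j
    | succ i =>
      induction j using Fin.cases with
      | zero => simpa using (key i).symm
      | succ j =>
        simp only [Fin.cons_succ]
        rw [Set.disjoint_left]
        intro x hx hx'
        have h1 : f x = (V.equivFin.symm i : ι) := hx.1
        have h2 : f x = (V.equivFin.symm j : ι) := hx'.1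
        have h3 : V.equivFin.symm i = V.equivFin.symm j := Subtype.ext (h1.symm.trans h2)
        exact hij (by rw [V.equivFin.symm.injective h3])
  · ext x
    simp only [mem_iUnion, mem_univ, iff_true]
    by_cases hx : x ∈ B ∪ (f ⁻¹' (V : Set ι))ᶜ
    · exact ⟨0, by simpa using hx⟩
    · simp only [mem_union, not_or, mem_compl_iff, not_not] at hx
      refine ⟨(V.equivFin ⟨f x, hx.2⟩).succ, ?_⟩
      simp only [Fin.cons_succ]
      refine ⟨?_, hx.1⟩
      simp
  · simpa using hμ
  · intro j hj x hx y hy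
    induction j using Fin.cases with
    | zero => exact absurd rfl hj
    | succ j =>
      simp only [Fin.cons_succ] at hx hy
      exact hd x hx.2 y hy.2 ((show f x = _ from hx.1).trans (show f y = _ from hy.1).symm)

lemma epsEntropy_le (μ : Measure X) (ρ : X → X → ℝ) (ε : ℝ) (k : ℕ)
    (hP : IsEntropyPartition μ ρ ε k) (a : ℝ) (ha : 0 ≤ a) (hk : (k : ℝ) ≤ 2 ^ a) :
    epsEntropy μ ρ ε ≤ ENNReal.ofReal a := by
  classical
  have h : ∃ k, IsEntropyPartition μ ρ ε k := ⟨k, hP⟩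
  unfold epsEntropy
  rw [dif_pos h]
  refine ENNReal.ofReal_le_ofReal ?_
  set l := Nat.find h with hl
  have hlk : l ≤ k := Nat.find_min' h hP
  rcases Nat.eq_zero_or_pos l with h0 | h0
  · rw [h0]; simpa using ha
  · have h1 : (0 : ℝ) < l := by exact_mod_cast h0
    have h2 : (l : ℝ) ≤ k := by exact_mod_cast hlk
    rw [Real.logb_le_iff_le_rpow (by norm_num) h1]
    exact h2.trans hk

lemma exists_of_epsEntropy_le (μ : Measure X) (ρ : X → X → ℝ) (ε a : ℝ) (ha : 0 ≤ a)
    (h : epsEntropy μ ρ ε ≤ ENNReal.ofReal a) :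
    ∃ k, IsEntropyPartition μ ρ ε k ∧ Real.logb 2 k ≤ a := by
  classical
  unfold epsEntropy at h
  split_ifs at h with hk
  · exact ⟨Nat.find hk, Nat.find_spec hk, (ENNReal.ofReal_le_ofReal_iff ha).1 h⟩
  · simp at h

open scoped Classical in
/-- Few names carry most of the mass. -/
lemma few_names {ι : Type*} [Fintype ι] (μ : Measure X) [IsProbabilityMeasure μ] (f : X → ι)
    (hf : ∀ i, MeasurableSet (f ⁻¹' {i})) (a b : ℝ) (ha : 0 < a) (hH : finEntropy μ f ≤ b * a) :
    ∃ V : Finset ι, (V.card : ℝ) ≤ 2 ^ a ∧ μ.real (f ⁻¹' (V : Set ι))ᶜ ≤ b := by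
  let p : ι → ℝ := fun i => (μ (f ⁻¹' {i})).toReal
  have hsum : ∀ V : Finset ι, ∑ w ∈ V, p w = μ.real (f ⁻¹' V) := fun V =>
    sum_measureReal_preimage_singleton V (fun w _ => hf w)
  let V : Finset ι := Finset.univ.filter (fun i => (2 : ℝ) ^ (-a) ≤ p i)
  refine ⟨V, ?_, ?_⟩
  · have h1 : (V.card : ℝ) * 2 ^ (-a) ≤ 1 := by
      calc (V.card : ℝ) * 2 ^ (-a) ≤ ∑ w ∈ V, p w := by
            rw [← nsmul_eq_mul]
            exact Finset.card_nsmul_le_sum _ _ _ fun i hi => (Finset.mem_filter.1 hi).2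
        _ ≤ 1 := by rw [hsum]; exact measureReal_le_one
    rw [Real.rpow_neg (by norm_num), ← div_eq_mul_inv, div_le_one (by positivity)] at h1
    exact h1
  · have h1 : (f ⁻¹' (V : Set ι))ᶜ = f ⁻¹' ((Vᶜ : Finset ι) : Set ι) := by
      simp
    rw [h1, ← hsum]
    have h2 : a * ∑ w ∈ Vᶜ, p w ≤ finEntropy μ f := by
      rw [Finset.mul_sum]
      calc ∑ w ∈ Vᶜ, a * p w ≤ ∑ w ∈ Vᶜ, -(p w * Real.logb 2 (p w)) := by
            refine Finset.sum_le_sum fun w hw => ?_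
            have hw' : p w < 2 ^ (-a) := by
              have : w ∉ V := Finset.mem_compl.1 hw
              simpa [V] using this
            rcases (ENNReal.toReal_nonneg : 0 ≤ p w).eq_or_lt with h0 | h0
            · have h0x : p w = 0 := h0.symm
              simp [h0x]
            · have h3 : Real.logb 2 (p w) ≤ -a := by
                rw [Real.logb_le_iff_le_rpow (by norm_num) h0]
                exact hw'.le
              nlinarith
        _ ≤ finEntropy μ f :=
            Finset.sum_le_sum_of_subset_of_nonneg (Finset.subset_univ _) fun i _ _ =>
              neg_mul_logb_nonneg ENNReal.toReal_nonneg (toReal_measure_le_one μ _)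
    have h4 : a * ∑ w ∈ Vᶜ, p w ≤ a * b := by linarith
    exact le_of_mul_le_mul_left h4 ha

open scoped Classical in
/-- A finite partition into sets of small diameter plus a set on which the distance
has small integral. -/
lemma exists_partition (μ : Measure X) [IsProbabilityMeasure μ]
    (ρ : X → X → ℝ) (hρ : IsSemimetric ρ) (hρm : Measurable (fun p : X × X => ρ p.1 p.2))
    (hρi : Integrable (fun p : X × X => ρ p.1 p.2) (μ.prod μ))
    (hadm : IsAdmissible μ ρ) (δ σ : ℝ) (hδ : 0 < δ) (hσ : 0 < σ) :
    ∃ (m : ℕ) (ξ : X → Fin m) (g : X → ℝ), (∀ i, MeasurableSet (ξ ⁻¹' {i})) ∧ Measurable g ∧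
      (∀ x, 0 ≤ g x) ∧ Integrable g μ ∧ ∫ x, g x ∂μ < σ ∧
      ∀ x y, ξ x = ξ y → ρ x y ≤ 2 * δ + g x + g y := by
  obtain ⟨s, hs, hsμ, D, hD, hDs, hdense⟩ := hadm
  have hne : s.Nonempty := by
    by_contra hcon
    rw [not_nonempty_iff_eq_empty] at hcon
    simp [hcon] at hsμ
  have hDne : D.Nonempty := by
    obtain ⟨x, hx⟩ := hne
    obtain ⟨y, hy, _⟩ := hdense x hx 1 one_pos
    exact ⟨y, hy⟩
  obtain ⟨y, hy⟩ := hD.exists_eq_range hDne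
  obtain ⟨y0, hy0⟩ := hρi.prod_left_ae.exists
  have hm : ∀ z, Measurable (fun x => ρ x z) := fun z =>
    hρm.comp (measurable_id.prodMk measurable_const)
  let S : ℕ → Set X := fun M => {x | ∀ j < M, δ ≤ ρ x (y j)}
  have hS : ∀ M, MeasurableSet (S M) := by
    intro M
    have : S M = ⋂ j, ⋂ (_ : j < M), (fun x => ρ x (y j)) ⁻¹' Ici δ := by
      ext x; simp [S]
    rw [this]
    exact MeasurableSet.iInter fun j => MeasurableSet.iInter fun _ => hm _ measurableSet_Ici
  have hanti : Antitone S := fun a b hab x hx j hj => hx j (hj.trans_le hab)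
  have hnull : μ (⋂ M, S M) = 0 := by
    refine measure_mono_null ?_ hsμ
    intro x hx hxs
    obtain ⟨z, hz, hzlt⟩ := hdense x hxs δ hδ
    rw [hy] at hz
    obtain ⟨j, rfl⟩ := hz
    have := mem_iInter.1 hx (j + 1) j (by omega)
    linarith
  have ht := tendsto_setIntegral_of_antitone (μ := μ) (f := fun x => ρ x y0) hS hanti
    ⟨0, hy0.integrableOn⟩
  rw [setIntegral_measure_zero _ hnull] at ht
  obtain ⟨M, hM⟩ := (ht.eventually (gt_mem_nhds hσ)).exists
  let ζ : X → (Fin M → Bool) := fun x j => decide (ρ x (y j) < δ)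
  have hζ : Measurable ζ := by
    refine measurable_pi_lambda _ fun j => measurable_to_bool ?_
    have : (fun x => ζ x j) ⁻¹' {true} = (fun x => ρ x (y j)) ⁻¹' Iio δ := by
      ext x; simp [ζ]
    rw [this]
    exact hm _ measurableSet_Iio
  let e := Fintype.equivFin (Fin M → Bool)
  refine ⟨_, fun x => e (ζ x), (S M).indicator (fun x => ρ x y0), ?_, (hm y0).indicator (hS M),
    fun x => indicator_nonneg (fun z _ => hρ.nonneg _ _) x, hy0.indicator (hS M), ?_, ?_⟩
  · intro i
    have : (fun x => e (ζ x)) ⁻¹' {i} = ζ ⁻¹' {e.symm i} := by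
      ext x; simp [Equiv.eq_symm_apply]
    rw [this]
    exact hζ (measurableSet_singleton _)
  · rw [integral_indicator (hS M)]; exact hM
  · intro a b hab
    have hab' : ζ a = ζ b := e.injective hab
    have hiff : ∀ j < M, (ρ a (y j) < δ ↔ ρ b (y j) < δ) := by
      intro j hj
      have := congrFun hab' ⟨j, hj⟩
      simpa [ζ] using this
    have hg0 : ∀ z, 0 ≤ (S M).indicator (fun x => ρ x y0) z :=
      fun z => indicator_nonneg (fun z _ => hρ.nonneg _ _) z
    by_cases ha : a ∈ S M
    · have hb : b ∈ S M := fun j hj => by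
        have h1 := ha j hj
        by_contra hcon
        have := (hiff j hj).2 (not_le.1 hcon)
        linarith
      rw [indicator_of_mem ha, indicator_of_mem hb]
      have := hρ.triangle a y0 b
      rw [hρ.symm y0 b] at this
      linarith
    · have : ∃ j, j < M ∧ ρ a (y j) < δ := by
        by_contra hcon
        push Not at hcon
        exact ha hcon
      obtain ⟨j, hj, hlt⟩ := this
      have hlt' := (hiff j hj).1 hlt
      have := hρ.triangle a (y j) b
      rw [hρ.symm (y j) b] at this
      have h1 := hg0 a
      have h2 := hg0 b
      linarith

lemma epsEntropy_small (μ : Measure X) [IsProbabilityMeasure μ] (T : Equiv.Perm X)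
    (hT : MeasurePreserving T μ μ)
    (ρ : X → X → ℝ) (hρ : IsSemimetric ρ) (hρm : Measurable (fun p : X × X => ρ p.1 p.2))
    (hρi : Integrable (fun p : X × X => ρ p.1 p.2) (μ.prod μ))
    (hadm : IsAdmissible μ ρ)
    (hsmall : ∀ (m : ℕ) (ξ : X → Fin m), (∀ i, MeasurableSet (ξ ⁻¹' {i})) → ∀ θ : ℝ, 0 < θ →
      ∀ᶠ n : ℕ in atTop, finEntropy μ (nName T ξ n) ≤ θ * n)
    (ε : ℝ) (hε : 0 < ε) (θ : ℝ) (hθ : 0 < θ) :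
    ∀ᶠ n : ℕ in atTop, epsEntropy μ (avgSemimetric T ρ n) ε ≤ ENNReal.ofReal (θ * n) := by
  obtain ⟨m, ξ, g, hξ, hgm, hg0, hgi, hgσ, hξρ⟩ := exists_partition μ ρ hρ hρm hρi hadm
    (ε / 4) (ε / 4 * (ε / 4)) (by positivity) (by positivity)
  filter_upwards [hsmall m ξ hξ (ε / 4 * θ) (by positivity), eventually_ge_atTop 1] with n hH hn
  have hn' : (0 : ℝ) < n := by exact_mod_cast hn
  let B : Set X := {x | ε / 4 ≤ (∑ i ∈ Finset.range n, g ((T ^ i) x)) / n}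
  have hB : MeasurableSet B := by
    refine measurableSet_le measurable_const ((Finset.measurable_sum _ fun i _ => ?_).div_const _)
    exact hgm.comp (mp_pow μ T hT i).measurable
  have hBμ : μ.real B < ε / 4 := by
    have h1 := markov_avg μ T hT g hg0 hgi n hn (ε / 4)
    exact lt_of_mul_lt_mul_left (h1.trans_lt hgσ) (by positivity)
  obtain ⟨V, hV, hVμ⟩ := few_names μ (nName T ξ n) (measurableSet_nName μ T hT ξ hξ n) (θ * n) (ε / 4)
    (by positivity) (by linarith)
  refine epsEntropy_le μ _ ε V.card ?_ _ (by positivity) hV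
  refine mkPartition μ _ ε (nName T ξ n) (measurableSet_nName μ T hT ξ hξ n) V B hB ?_ ?_
  · rw [ENNReal.lt_ofReal_iff_toReal_lt (measure_ne_top _ _)]
    have := measureReal_union_le (μ := μ) B (nName T ξ n ⁻¹' (V : Set (Fin n → Fin m)))ᶜ
    change μ.real _ < ε
    linarith
  · intro x hx y hy hxy
    have hx' : (∑ i ∈ Finset.range n, g ((T ^ i) x)) / n < ε / 4 := not_le.1 hx
    have hy' : (∑ i ∈ Finset.range n, g ((T ^ i) y)) / n < ε / 4 := not_le.1 hy
    have hle : avgSemimetric T ρ n x y ≤ 2 * (ε / 4) +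
        (∑ i ∈ Finset.range n, g ((T ^ i) x)) / n + (∑ i ∈ Finset.range n, g ((T ^ i) y)) / n := by
      unfold avgSemimetric
      calc (∑ k ∈ Finset.range n, ρ ((T ^ k) x) ((T ^ k) y)) / (n : ℝ) ≤
          (∑ k ∈ Finset.range n, (2 * (ε / 4) + g ((T ^ k) x) + g ((T ^ k) y))) / (n : ℝ) := by
            gcongr with k hk
            exact hξρ _ _ (congrFun hxy ⟨k, Finset.mem_range.1 hk⟩)
        _ = _ := by
            rw [Finset.sum_add_distrib, Finset.sum_add_distrib]
            simp only [Finset.sum_const, Finset.card_range, nsmul_eq_mul]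
            field_simp
    linarith

lemma kolmogorov_zero_iff (μ : Measure X) [IsProbabilityMeasure μ] (T : Equiv.Perm X)
    (hT : MeasurePreserving T μ μ) (hTsymm : Measurable (⇑T.symm)) :
    kolmogorovEntropy μ T = 0 ↔
      ∀ (m : ℕ) (ξ : X → Fin m), (∀ i, MeasurableSet (ξ ⁻¹' {i})) → ∀ θ : ℝ, 0 < θ →
      ∀ᶠ n : ℕ in atTop, finEntropy μ (nName T ξ n) ≤ θ * n := by
  have key : ∀ (m : ℕ) (ξ : X → Fin m), (∀ i, MeasurableSet (ξ ⁻¹' {i})) → ∀ θ : ℝ, 0 < θ →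
      ∀ n : ℕ, 1 ≤ n → (finEntropy μ (nName T ξ n) ≤ θ * n ↔
        partitionEntropy μ (fun x => fun i : Fin n => ξ ((T ^ (-(i : ℤ))) x)) / (n : ℝ≥0∞) ≤
          ENNReal.ofReal θ) := by
    intro m ξ hξ θ hθ n hn
    rw [partitionEntropy_eq, finEntropy_backward μ T hT hTsymm ξ hξ n,
      ENNReal.div_le_iff (by simp; omega) (by simp), ← ENNReal.ofReal_natCast n,
      ← ENNReal.ofReal_mul hθ.le, ENNReal.ofReal_le_ofReal_iff (by positivity)]
  unfold kolmogorovEntropy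
  simp only [ENNReal.iSup_eq_zero]
  refine forall_congr' fun m => forall_congr' fun ξ => forall_congr' fun hξ => ?_
  constructor
  · intro h θ hθ
    have h1 := eventually_lt_of_limsup_lt (h.trans_lt (ENNReal.ofReal_pos.2 hθ))
    filter_upwards [h1, eventually_ge_atTop 1] with n hn hn1
    exact (key m ξ hξ θ hθ n hn1).2 hn.le
  · intro h
    refine le_antisymm (ENNReal.le_of_forall_pos_le_add fun θ hθ _ => ?_) zero_le
    rw [zero_add]
    refine limsup_le_of_le (by isBoundedDefault) ?_
    filter_upwards [h θ (by exact_mod_cast hθ), eventually_ge_atTop 1] with n hn hn1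
    have := (key m ξ hξ θ (by exact_mod_cast hθ) n hn1).1 hn
    simpa using this

/-- If `h` is a scaling entropy sequence of an ergodic system `(X,μ,T)`, then the
Kolmogorov entropy vanishes if and only if `h_n = o(n)` as `n → ∞`. -/
theorem kolmogorovEntropy_eq_zero_iff_isLittleO
    {X : Type*} [MeasurableSpace X] [StandardBorelSpace X]
    (μ : Measure X) [IsProbabilityMeasure μ]
    (T : Equiv.Perm X) (hT : Measurable (⇑T)) (hTsymm : Measurable (⇑T.symm))
    (hTerg : Ergodic (⇑T) μ)
    (h : ℕ → ℝ) (hh : IsScalingEntropySeq μ T h) :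
    kolmogorovEntropy μ T = 0 ↔ Asymptotics.IsLittleO Filter.atTop h (fun n => (n : ℝ)) := by
  have hmp : MeasurePreserving (⇑T) μ μ := hTerg.toMeasurePreserving
  obtain ⟨ρ, hρ, hρm, hρi, hadm, hgen, hpos, hsup, ε₀, hε₀, hinf⟩ := hh
  rw [kolmogorov_zero_iff μ T hmp hTsymm]
  constructor
  · intro hsmall
    have hlim := hinf (ε₀ / 2) (by positivity) (by linarith)
    obtain ⟨c, hc0, hc⟩ := exists_between hlim
    have hcT : c ≠ ⊤ := hc.ne_top
    have hc0' : 0 < c.toReal := ENNReal.toReal_pos hc0.ne' hcT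
    rw [Asymptotics.isLittleO_iff]
    intro b hb
    filter_upwards [eventually_lt_of_lt_liminf hc, epsEntropy_small μ T hmp ρ hρ hρm hρi hadm
      hsmall (ε₀ / 2) (by positivity) (c.toReal * b) (by positivity), eventually_ge_atTop 1]
      with n h1 h2 hn
    have hhn := hpos n hn
    have h3 : c * ENNReal.ofReal (h n) ≤ ENNReal.ofReal (c.toReal * b * n) := by
      refine le_trans ?_ h2
      exact ENNReal.mul_le_of_le_div h1.le
    have h4 : c * ENNReal.ofReal (h n) = ENNReal.ofReal (c.toReal * h n) := by
      rw [ENNReal.ofReal_mul hc0'.le, ENNReal.ofReal_toReal hcT]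
    rw [h4, ENNReal.ofReal_le_ofReal_iff (by positivity), mul_assoc] at h3
    have h5 := le_of_mul_le_mul_left h3 hc0'
    rw [Real.norm_of_nonneg hhn.le, Real.norm_of_nonneg (by positivity)]
    exact h5
  · intro hlo m ξ hξ θ hθ
    refine entropy_small μ T hmp hTsymm ρ hρ hρm hadm hgen ?_ ξ hξ θ hθ
    intro ε hε θ' hθ'
    obtain ⟨C, hC, hCT⟩ := exists_between (hsup ε hε)
    have hCT' : C ≠ ⊤ := hCT.ne
    have hC0 : 0 < C.toReal := ENNReal.toReal_pos (pos_of_gt hC).ne' hCT'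
    rw [Asymptotics.isLittleO_iff] at hlo
    filter_upwards [eventually_lt_of_limsup_lt hC, hlo (show 0 < θ' / C.toReal by positivity),
      eventually_ge_atTop 1] with n h1 h2 hn
    have hhn := hpos n hn
    refine exists_of_epsEntropy_le μ _ ε _ (by positivity) ?_
    rw [Real.norm_of_nonneg hhn.le, Real.norm_of_nonneg (by positivity)] at h2
    have h3 := (ENNReal.div_le_iff (by simpa using hhn) ENNReal.ofReal_ne_top).1 h1.le
    refine h3.trans ?_
    rw [← ENNReal.ofReal_toReal hCT', ← ENNReal.ofReal_mul hC0.le]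
    refine ENNReal.ofReal_le_ofReal ?_
    calc C.toReal * h n ≤ C.toReal * (θ' / C.toReal * n) := by gcongr
      _ = θ' * n := by field_simp
end

section
/- Let T be an ergodic automorphism of a standard probability space (X,μ). If the class ℋ(X,μ,T) of scaling entropy sequences of (X,μ,T) consists exactly of all sequences of positive numbers that are bounded and separated from zero, then the Koopman operator U_T: L²(X,μ) → L²(X,μ), U_T f = f∘T, has purely point spectrum (i.e., L²(X,μ) possesses an orthonormal basis consisting of eigenfunctions of U_T). -/
open MeasureTheory Filter Set
open scoped ENNReal

variable {X : Type*} [MeasurableSpace X]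

open scoped Topology

section Hilb
variable {H : Type*} [NormedAddCommGroup H] [InnerProductSpace ℂ H]

lemma pos_bound (A : H →L[ℂ] H) (hs : A.IsSymmetric)
    (hp : ∀ x, 0 ≤ (inner ℂ (A x) x).re) (y : H) :
    ‖A y‖ ^ 2 ≤ (‖A‖ + 1) * (inner ℂ (A y) y).re := by
  have hN : 0 < ‖A‖ + 1 := by positivity
  set t : ℝ := (‖A‖ + 1)⁻¹ with ht
  have h1 := hp (y - (t : ℂ) • A y)
  have h2 : inner ℂ (A (A y)) y = inner ℂ (A y) (A y) := hs (A y) y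
  have h3 : (inner ℂ (A (A y)) (A y)).re ≤ ‖A‖ * ‖A y‖ ^ 2 := by
    calc (inner ℂ (A (A y)) (A y)).re ≤ ‖A (A y)‖ * ‖A y‖ := re_inner_le_norm (𝕜 := ℂ) _ _
      _ ≤ ‖A‖ * ‖A y‖ * ‖A y‖ := by gcongr; exact A.le_opNorm _
      _ = _ := by ring
  have h4 : (inner ℂ (A y) (A y)).re = ‖A y‖ ^ 2 := by
    rw [inner_self_eq_norm_sq_to_K]; norm_cast
  simp only [map_sub, map_smul, inner_sub_left, inner_sub_right, inner_smul_left,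
    inner_smul_right, h2, Complex.conj_ofReal] at h1
  simp only [Complex.sub_re, Complex.re_ofReal_mul, h4] at h1
  have h5 : t * (‖A‖ + 1) = 1 := by rw [ht]; field_simp
  have h6 : 0 < t := by positivity
  have h7 : t ^ 2 * (inner ℂ (A (A y)) (A y)).re ≤ t ^ 2 * (‖A‖ * ‖A y‖ ^ 2) := by gcongr
  have h8 : t * ‖A y‖ ^ 2 ≤ (inner ℂ (A y) y).re := by
    have : t ^ 2 * (‖A‖ * ‖A y‖ ^ 2) ≤ t * ‖A y‖ ^ 2 := by
      have : t ^ 2 * (‖A‖ * ‖A y‖ ^ 2) = (t * (t * (‖A‖ + 1)) - t ^ 2) * ‖A y‖ ^ 2 := by ring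
      rw [this, h5]
      gcongr
      nlinarith
    nlinarith
  calc ‖A y‖ ^ 2 = (‖A‖ + 1) * (t * ‖A y‖ ^ 2) := by rw [← mul_assoc, mul_comm (‖A‖ + 1), h5, one_mul]
    _ ≤ _ := by gcongr

lemma compact_of_trace [CompleteSpace H] (A : H →L[ℂ] H) (hs : A.IsSymmetric)
    (hp : ∀ x, 0 ≤ (inner ℂ (A x) x).re) (C : ℝ)
    (hC : ∀ (n : ℕ) (e : Fin n → H), Orthonormal ℂ e → ∑ i, (inner ℂ (A (e i)) (e i)).re ≤ C) :
    IsCompactOperator A := by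
  have key : ∀ δ : ℝ, 0 < δ → ∃ V : Submodule ℂ H, FiniteDimensional ℂ V ∧
      ∀ y ∈ Vᗮ, (inner ℂ (A y) y).re ≤ δ * ‖y‖ ^ 2 := by
    intro δ hδ
    let S : Set ℝ := {s | ∃ (n : ℕ) (e : Fin n → H), Orthonormal ℂ e ∧
      s = ∑ i, (inner ℂ (A (e i)) (e i)).re}
    have hbdd : BddAbove S := ⟨C, by rintro s ⟨n, e, he, rfl⟩; exact hC n e he⟩
    have hne : S.Nonempty := ⟨_, 0, Fin.elim0, ⟨fun i => i.elim0, fun i => i.elim0⟩, rfl⟩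
    obtain ⟨s, ⟨n, e, he, rfl⟩, hlt⟩ := exists_lt_of_lt_csSup hne (sub_lt_self (sSup S) hδ)
    refine ⟨Submodule.span ℂ (Set.range e), FiniteDimensional.span_of_finite ℂ (Set.finite_range e), ?_⟩
    intro y hy
    rcases eq_or_ne y 0 with rfl | hy0
    · simp
    have hny : ‖y‖ ≠ 0 := norm_ne_zero_iff.2 hy0
    set c : ℂ := ((‖y‖⁻¹ : ℝ) : ℂ) with hc
    have horth : ∀ i, inner ℂ (e i) y = 0 := fun i =>
      (Submodule.mem_orthogonal _ _).1 hy _ (Submodule.subset_span ⟨i, rfl⟩)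
    have horth' : ∀ i, inner ℂ y (e i) = 0 := fun i => by
      rw [← inner_conj_symm, horth, map_zero]
    have hon : Orthonormal ℂ (Fin.cons (c • y) e : Fin (n + 1) → H) := by
      constructor
      · intro i
        refine Fin.cases ?_ (fun j => ?_) i
        · simp [norm_smul, hc, hny]
        · simpa using he.1 j
      · intro i j
        refine Fin.cases ?_ (fun i => ?_) i <;> refine Fin.cases ?_ (fun j => ?_) j
        · simp
        · intro _; simp [inner_smul_left, horth']
        · intro _; simp [inner_smul_right, horth]
        · intro h; simpa using he.2 (fun h' => h (by rw [h']))
    have hle := le_csSup hbdd (show _ ∈ S from ⟨_, _, hon, rfl⟩)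
    rw [Fin.sum_univ_succ] at hle
    simp only [Fin.cons_zero, Fin.cons_succ, map_smul, inner_smul_left, inner_smul_right] at hle
    rw [hc, Complex.conj_ofReal, Complex.re_ofReal_mul, Complex.re_ofReal_mul] at hle
    have h1 : ‖y‖⁻¹ * (‖y‖⁻¹ * (inner ℂ (A y) y).re) ≤ δ := by linarith
    have h2 := mul_le_mul_of_nonneg_right h1 (sq_nonneg ‖y‖)
    calc _ = ‖y‖⁻¹ * (‖y‖⁻¹ * (inner ℂ (A y) y).re) * ‖y‖ ^ 2 := by field_simp
      _ ≤ _ := h2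
  have hcl : IsClosed {f : H →L[ℂ] H | IsCompactOperator f} := isClosed_setOfPred_isCompactOperator
  suffices A ∈ closure {f : H →L[ℂ] H | IsCompactOperator f} by
    rwa [hcl.closure_eq] at this
  rw [Metric.mem_closure_iff]
  intro ε hε
  obtain ⟨V, hV, hVy⟩ := key ((ε / 2) ^ 2 / (‖A‖ + 1)) (by positivity)
  refine ⟨A ∘L V.starProjection, ?_, ?_⟩
  · have : ProperSpace V := FiniteDimensional.proper ℂ V
    have : IsCompactOperator (V.orthogonalProjectionOnto) :=
      isCompactOperator_of_locallyCompactSpace_dom (V.orthogonalProjectionOnto)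
    have := this.clm_comp (A ∘L V.subtypeL)
    exact this
  · rw [dist_eq_norm]
    refine lt_of_le_of_lt (ContinuousLinearMap.opNorm_le_bound _ (by positivity : 0 ≤ ε / 2) ?_) (by linarith)
    intro x
    have hx : (A - A ∘L V.starProjection) x = A (x - V.starProjection x) := by simp
    rw [hx]
    set y := x - V.starProjection x with hy
    have hyV : y ∈ Vᗮ := Submodule.sub_starProjection_mem_orthogonal x
    have hyn : ‖y‖ ≤ ‖x‖ := by
      have : y = Vᗮ.starProjection x := by
        rw [Submodule.starProjection_orthogonal_val]
      rw [this]
      exact Submodule.norm_starProjection_apply_le _ _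
    have h1 := pos_bound A hs hp y
    have h2 := hVy y hyV
    have h3 : ‖A y‖ ^ 2 ≤ (ε / 2 * ‖y‖) ^ 2 := by
      calc ‖A y‖ ^ 2 ≤ (‖A‖ + 1) * ((ε / 2) ^ 2 / (‖A‖ + 1) * ‖y‖ ^ 2) := by
            refine h1.trans ?_
            gcongr
        _ = _ := by field_simp
    have h4 := abs_le_of_sq_le_sq h3 (by positivity)
    calc ‖A y‖ ≤ ε / 2 * ‖y‖ := (le_abs_self _).trans h4
      _ ≤ _ := by gcongr

lemma eig_orth (U : H →ₗᵢ[ℂ] H) (v : H) (hv : ∀ (c : ℂ) (u : H), U u = c • u → inner ℂ u v = 0)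
    (k : ℕ) : ∀ (c : ℂ) (u : H), U u = c • u → inner ℂ u (U^[k] v) = 0 := by
  induction k with
  | zero => simpa using hv
  | succ k ih =>
    intro c u hu
    rw [Function.iterate_succ_apply']
    rcases eq_or_ne u 0 with rfl | hu0
    · simp
    have hc : c ≠ 0 := by
      rintro rfl
      rw [zero_smul] at hu
      exact hu0 ((map_eq_zero_iff U U.injective).1 hu)
    have h1 : inner ℂ (U u) (U (U^[k] v)) = 0 := by
      rw [U.inner_map_map]; exact ih c u hu
    rw [hu, inner_smul_left] at h1
    simpa [hc] using h1

lemma exists_limit_op [CompleteSpace H] (w : ℕ → H) (R : ℝ) (hwn : ∀ k, ‖w k‖ = R)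
    (F : Ultrafilter ℕ) : ∃ A : H →L[ℂ] H, ∀ x y, Tendsto (fun n : ℕ => (n : ℂ)⁻¹ *
      ∑ k ∈ Finset.range n, inner ℂ x (w k) * inner ℂ (w k) y) F (𝓝 (inner ℂ (A x) y)) := by
  let a : ℕ → H → H → ℂ := fun n x y =>
    (n : ℂ)⁻¹ * ∑ k ∈ Finset.range n, inner ℂ x (w k) * inner ℂ (w k) y
  have hterm : ∀ k x y, ‖inner ℂ x (w k) * inner ℂ (w k) y‖ ≤ R ^ 2 * ‖x‖ * ‖y‖ := by
    intro k x y
    rw [norm_mul]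
    calc _ ≤ (‖x‖ * ‖w k‖) * (‖w k‖ * ‖y‖) := by gcongr <;> exact norm_inner_le_norm _ _
      _ = _ := by rw [hwn]; ring
  have habd : ∀ n x y, ‖a n x y‖ ≤ R ^ 2 * ‖x‖ * ‖y‖ := by
    intro n x y
    rcases Nat.eq_zero_or_pos n with rfl | hn
    · simp only [a, Finset.range_zero, Finset.sum_empty, mul_zero, norm_zero]; positivity
    have hn' : (0 : ℝ) < n := by exact_mod_cast hn
    calc ‖a n x y‖ = (n : ℝ)⁻¹ * ‖∑ k ∈ Finset.range n, inner ℂ x (w k) * inner ℂ (w k) y‖ := by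
          simp [a]
      _ ≤ (n : ℝ)⁻¹ * ∑ k ∈ Finset.range n, R ^ 2 * ‖x‖ * ‖y‖ := by
          gcongr
          exact (norm_sum_le _ _).trans (Finset.sum_le_sum fun k _ => hterm k x y)
      _ = _ := by simp; field_simp
  have hex : ∀ x y, ∃ l, Tendsto (fun n => a n x y) F (𝓝 l) := by
    intro x y
    obtain ⟨l, -, hl⟩ := (isCompact_closedBall (0 : ℂ) (R ^ 2 * ‖x‖ * ‖y‖)).ultrafilter_le_nhds
      (F.map (fun n => a n x y)) (by
        rw [le_principal_iff]
        exact Filter.mem_map.2 (Filter.univ_mem' (fun n => by simpa using habd n x y)))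
    exact ⟨l, hl⟩
  choose L hL using hex
  have hLbd : ∀ x y, ‖L x y‖ ≤ R ^ 2 * ‖x‖ * ‖y‖ := fun x y =>
    le_of_tendsto (hL x y).norm (Eventually.of_forall fun n => habd n x y)
  let B : H →L⋆[ℂ] H →L[ℂ] ℂ := LinearMap.mkContinuous₂
    (LinearMap.mk₂'ₛₗ (starRingEnd ℂ) (RingHom.id ℂ) L
      (fun x x' y => tendsto_nhds_unique (hL _ _) (((hL x y).add (hL x' y)).congr fun n => by
        simp only [a, inner_add_left, add_mul, Finset.sum_add_distrib, mul_add]))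
      (fun c x y => tendsto_nhds_unique (hL _ _) (((hL x y).const_mul (starRingEnd ℂ c)).congr fun n => by
        simp only [a, inner_smul_left, Finset.mul_sum]
        exact Finset.sum_congr rfl fun k _ => by ring))
      (fun x y y' => tendsto_nhds_unique (hL _ _) (((hL x y).add (hL x y')).congr fun n => by
        simp only [a, inner_add_right, mul_add, Finset.sum_add_distrib]))
      (fun c x y => tendsto_nhds_unique (hL _ _) (((hL x y).const_mul c).congr fun n => by
        simp only [a, inner_smul_right, Finset.mul_sum]
        exact Finset.sum_congr rfl fun k _ => by ring)))
    (R ^ 2) hLbd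
  let A : H →L[ℂ] H := InnerProductSpace.continuousLinearMapOfBilin B
  have hA : ∀ x y, inner ℂ (A x) y = L x y := fun x y =>
    InnerProductSpace.continuousLinearMapOfBilin_apply B x y
  refine ⟨A, fun x y => ?_⟩
  rw [hA]
  exact hL x y

lemma wm_ultra [CompleteSpace H] (U : H →ₗᵢ[ℂ] H) (hU : Function.Surjective U) (v : H)
    (hv : ∀ (c : ℂ) (u : H), U u = c • u → inner ℂ u v = 0)
    (F : Ultrafilter ℕ) (hF : (F : Filter ℕ) ≤ atTop) :
    Tendsto (fun n : ℕ => (n : ℂ)⁻¹ * ∑ k ∈ Finset.range n,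
      inner ℂ v (U^[k] v) * inner ℂ (U^[k] v) v) F (𝓝 0) := by
  set w : ℕ → H := fun k => U^[k] v with hw
  have hwn : ∀ k, ‖w k‖ = ‖v‖ := by
    intro k
    induction k with
    | zero => rfl
    | succ k ih => simp only [hw, Function.iterate_succ_apply'] at ih ⊢; rw [U.norm_map]; exact ih
  let a : ℕ → H → H → ℂ := fun n x y =>
    (n : ℂ)⁻¹ * ∑ k ∈ Finset.range n, inner ℂ x (w k) * inner ℂ (w k) y
  have hterm : ∀ k x y, ‖inner ℂ x (w k) * inner ℂ (w k) y‖ ≤ ‖v‖ ^ 2 * ‖x‖ * ‖y‖ := by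
    intro k x y
    rw [norm_mul]
    calc _ ≤ (‖x‖ * ‖w k‖) * (‖w k‖ * ‖y‖) := by gcongr <;> exact norm_inner_le_norm _ _
      _ = _ := by rw [hwn]; ring
  obtain ⟨A, hL⟩ := exists_limit_op w ‖v‖ hwn F
  have hsymm : A.IsSymmetric := by
    intro x y
    show inner ℂ (A x) y = inner ℂ x (A y)
    rw [← inner_conj_symm x (A y)]
    refine tendsto_nhds_unique (hL x y) ?_
    refine ((Complex.continuous_conj.tendsto _).comp (hL y x)).congr fun n => ?_
    simp only [Function.comp, map_mul, map_sum, map_inv₀, Complex.conj_natCast, inner_conj_symm]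
    congr 1
    exact Finset.sum_congr rfl fun k _ => by ring
  have hself : ∀ n x, (a n x x).re = (n : ℝ)⁻¹ * ∑ k ∈ Finset.range n, ‖inner ℂ x (w k)‖ ^ 2 := by
    intro n x
    have : a n x x = (((n : ℝ)⁻¹ * ∑ k ∈ Finset.range n, ‖inner ℂ x (w k)‖ ^ 2 : ℝ) : ℂ) := by
      simp only [a]
      push_cast
      congr 1
      refine Finset.sum_congr rfl fun k _ => ?_
      rw [← inner_conj_symm (w k) x, Complex.mul_conj, Complex.normSq_eq_norm_sq]
      push_cast; rfl
    rw [this, Complex.ofReal_re]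
  have hre : ∀ x, Tendsto (fun n => (a n x x).re) F (𝓝 (inner ℂ (A x) x).re) := by
    intro x
    exact (Complex.continuous_re.tendsto _).comp (hL x x)
  have hpos : ∀ x, 0 ≤ (inner ℂ (A x) x).re := by
    intro x
    refine ge_of_tendsto (hre x) (Eventually.of_forall fun n => ?_)
    rw [hself]; positivity
  have hcomp : IsCompactOperator A := by
    refine compact_of_trace A hsymm hpos (‖v‖ ^ 2) fun m e he => ?_
    refine le_of_tendsto (tendsto_finsetSum Finset.univ fun i _ => hre (e i))
      (Eventually.of_forall fun n => ?_)
    simp only [hself]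
    rw [← Finset.mul_sum, Finset.sum_comm]
    rcases Nat.eq_zero_or_pos n with rfl | hn
    · simp
    have hn' : (0 : ℝ) < n := by exact_mod_cast hn
    calc _ ≤ (n : ℝ)⁻¹ * ∑ k ∈ Finset.range n, ‖v‖ ^ 2 := by
          gcongr with k _
          rw [← hwn k]
          exact he.sum_inner_products_le (w k)
      _ = _ := by simp; field_simp
  have hLU : ∀ x y, inner ℂ (A (U x)) (U y) = inner ℂ (A x) y := by
    intro x y
    have h0 : Tendsto (fun n => a n (U x) (U y) - a n x y) F (𝓝 0) := by
      refine Tendsto.mono_left ?_ hF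
      refine squeeze_zero_norm (a := fun n : ℕ => (n : ℝ)⁻¹ * (2 * (‖v‖ ^ 2 * ‖U x‖ * ‖U y‖))) ?_ ?_
      · intro n
        have : a n (U x) (U y) - a n x y = (n : ℂ)⁻¹ *
            (inner ℂ (U x) (w 0) * inner ℂ (w 0) (U y) - inner ℂ (U x) (w n) * inner ℂ (w n) (U y)) := by
          have h1 := Finset.sum_range_sub' (fun k => inner ℂ (U x) (w k) * inner ℂ (w k) (U y)) n
          have h2 : ∀ k, inner ℂ (U x) (w (k + 1)) * inner ℂ (w (k + 1)) (U y)
              = inner ℂ x (w k) * inner ℂ (w k) y := by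
            intro k
            have : w (k + 1) = U (w k) := Function.iterate_succ_apply' U k v
            rw [this, U.inner_map_map, U.inner_map_map]
          rw [← h1, Finset.sum_sub_distrib, mul_sub, Finset.sum_congr rfl fun k _ => h2 k]
        rw [this, norm_mul, norm_inv, Complex.norm_natCast]
        gcongr
        refine (norm_sub_le _ _).trans ?_
        linarith [hterm 0 (U x) (U y), hterm n (U x) (U y)]
      · have := (tendsto_inv_atTop_nhds_zero_nat (𝕜 := ℝ)).mul_const (2 * (‖v‖ ^ 2 * ‖U x‖ * ‖U y‖))
        simpa using this
    have := tendsto_nhds_unique h0 ((hL (U x) (U y)).sub (hL x y))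
    exact (sub_eq_zero.1 this.symm)
  have hcomm : ∀ x, A (U x) = U (A x) := by
    intro x
    refine ext_inner_right ℂ fun z => ?_
    obtain ⟨y, rfl⟩ := hU z
    rw [hLU, U.inner_map_map]
  have hA0 : A = 0 := by
    rw [← ContinuousLinearMap.eq_zero_of_forall_hasEigenvalue_eq_zero hcomp hsymm]
    intro μ hμ
    by_contra hμ0
    have := ContinuousLinearMap.finite_dimensional_eigenspace hcomp μ hμ0
    let E := Module.End.eigenspace (A : H →ₗ[ℂ] H) μ
    have hmap : ∀ x ∈ E, U.toLinearMap x ∈ E := by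
      intro x hx
      have hx' : A x = μ • x := Module.End.mem_eigenspace_iff.1 hx
      refine Module.End.mem_eigenspace_iff.2 ?_
      show A (U x) = μ • U x
      rw [hcomm, hx', map_smul]
    have : FiniteDimensional ℂ E := this
    have : Nontrivial E := by
      obtain ⟨x, hx⟩ := hμ.exists_hasEigenvector
      exact ⟨⟨x, hx.1⟩, 0, fun h => hx.2 (congrArg Subtype.val h)⟩
    obtain ⟨c, hc⟩ := Module.End.exists_eigenvalue (U.toLinearMap.restrict hmap)
    obtain ⟨u, hu⟩ := hc.exists_hasEigenvector
    have hu1 : U (u : H) = c • (u : H) := by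
      have := congrArg Subtype.val (Module.End.mem_eigenspace_iff.1 hu.1)
      simpa using this
    have hu0 : (u : H) ≠ 0 := fun h => hu.2 (Subtype.ext h)
    have hAu : A (u : H) = μ • (u : H) := Module.End.mem_eigenspace_iff.1 u.2
    have hAu0 : A (u : H) = 0 := by
      refine ext_inner_right ℂ fun y => ?_
      rw [inner_zero_left]
      refine tendsto_nhds_unique (hL _ _) (tendsto_const_nhds.congr fun n => ?_)
      simp [hw, eig_orth U v hv _ c u hu1]
    rw [hAu0] at hAu
    exact (smul_ne_zero hμ0 hu0) hAu.symm
  have := hL v v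
  rw [hA0] at this
  simpa only [zero_apply, inner_zero_left] using this

lemma wm_tendsto [CompleteSpace H] (U : H →ₗᵢ[ℂ] H) (hU : Function.Surjective U) (v : H)
    (hv : ∀ (c : ℂ) (u : H), U u = c • u → inner ℂ u v = 0) :
    Tendsto (fun n : ℕ => (n : ℝ)⁻¹ * ∑ k ∈ Finset.range n,
      ‖(inner ℂ v (U^[k] v) : ℂ)‖ ^ 2) atTop (𝓝 0) := by
  have h : Tendsto (fun n : ℕ => (n : ℂ)⁻¹ * ∑ k ∈ Finset.range n,
      inner ℂ v (U^[k] v) * inner ℂ (U^[k] v) v) atTop (𝓝 0) := by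
    rw [tendsto_iff_ultrafilter]
    intro F hF
    exact wm_ultra U hU v hv F hF
  have h2 := (Complex.continuous_re.tendsto _).comp h
  simp only [Complex.zero_re] at h2
  refine h2.congr fun n => ?_
  have : (n : ℂ)⁻¹ * ∑ k ∈ Finset.range n, inner ℂ v (U^[k] v) * inner ℂ (U^[k] v) v
      = (((n : ℝ)⁻¹ * ∑ k ∈ Finset.range n, ‖(inner ℂ v (U^[k] v) : ℂ)‖ ^ 2 : ℝ) : ℂ) := by
    push_cast
    congr 1
    refine Finset.sum_congr rfl fun k _ => ?_
    rw [← inner_conj_symm (U^[k] v) v, Complex.mul_conj, Complex.normSq_eq_norm_sq]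
    push_cast; rfl
  rw [Function.comp, this, Complex.ofReal_re]

lemma inner_iter (U : H →ₗᵢ[ℂ] H) (k : ℕ) (x y : H) :
    inner ℂ (U^[k] x) (U^[k] y) = inner ℂ x y := by
  induction k with
  | zero => rfl
  | succ k ih => rw [Function.iterate_succ_apply', Function.iterate_succ_apply', U.inner_map_map, ih]

lemma norm_iter (U : H →ₗᵢ[ℂ] H) (k : ℕ) (x : H) : ‖U^[k] x‖ = ‖x‖ := by
  induction k with
  | zero => rfl
  | succ k ih => rw [Function.iterate_succ_apply', U.norm_map, ih]

lemma vdc [CompleteSpace H] (U : H →ₗᵢ[ℂ] H) (hU : Function.Surjective U) (v : H)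
    (hv : ∀ (c : ℂ) (u : H), U u = c • u → inner ℂ u v = 0) :
    ∃ η : ℕ → ℝ, Tendsto η atTop (𝓝 0) ∧ ∀ (n : ℕ) (M : ℝ) (c : ℕ → ℂ), 0 ≤ M →
      (∀ k, ‖c k‖ ≤ M) → (n : ℝ)⁻¹ * ‖∑ k ∈ Finset.range n, c k • (U^[k] v)‖ ≤ M * η n := by
  set b : ℕ → ℝ := fun m => ‖(inner ℂ v (U^[m] v) : ℂ)‖ with hb
  have hb0 : ∀ m, 0 ≤ b m := fun m => norm_nonneg _
  have hs := wm_tendsto U hU v hv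
  refine ⟨fun n => √(2 * √((n : ℝ)⁻¹ * ∑ k ∈ Finset.range n, b k ^ 2)), ?_, ?_⟩
  · have := ((hs.sqrt).const_mul 2).sqrt
    simpa using this
  intro n M c hM hc
  rcases Nat.eq_zero_or_pos n with rfl | hn
  · simp
  have hn' : (0 : ℝ) < n := by exact_mod_cast hn
  have hle : ∀ j k, j ≤ k → ‖(inner ℂ (U^[j] v) (U^[k] v) : ℂ)‖ = b (k - j) := by
    intro j k hjk
    obtain ⟨d, rfl⟩ := Nat.exists_eq_add_of_le hjk
    rw [Function.iterate_add_apply, inner_iter, Nat.add_sub_cancel_left]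
  have hge : ∀ j k, k ≤ j → ‖(inner ℂ (U^[j] v) (U^[k] v) : ℂ)‖ = b (j - k) := by
    intro j k hjk
    rw [norm_inner_symm, hle k j hjk]
  have hrow : ∀ j ∈ Finset.range n, ∑ k ∈ Finset.range n, ‖(inner ℂ (U^[j] v) (U^[k] v) : ℂ)‖
      ≤ 2 * ∑ m ∈ Finset.range n, b m := by
    intro j hj
    obtain ⟨r, hr⟩ := Nat.exists_eq_add_of_le (Nat.succ_le_of_lt (Finset.mem_range.1 hj))
    have e1 : ∑ k ∈ Finset.range (j + 1), ‖(inner ℂ (U^[j] v) (U^[k] v) : ℂ)‖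
        = ∑ m ∈ Finset.range (j + 1), b m := by
      rw [← Finset.sum_range_reflect]
      refine Finset.sum_congr rfl fun k hk => ?_
      have := Finset.mem_range.1 hk
      rw [hge _ _ (by omega)]
      congr 1; omega
    have e2 : ∑ k ∈ Finset.range r, ‖(inner ℂ (U^[j] v) (U^[j + 1 + k] v) : ℂ)‖
        = ∑ m ∈ Finset.range r, b (m + 1) := by
      refine Finset.sum_congr rfl fun k hk => ?_
      rw [hle _ _ (by omega)]
      congr 1; omega
    have e3 : ∑ m ∈ Finset.range r, b (m + 1) ≤ ∑ m ∈ Finset.range n, b m := by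
      calc _ ≤ ∑ m ∈ Finset.range (r + 1), b m := by
            rw [Finset.sum_range_succ']; linarith [hb0 0]
        _ ≤ _ := Finset.sum_le_sum_of_subset_of_nonneg
            (Finset.range_subset_range.2 (by omega)) fun m _ _ => hb0 m
    have e4 : ∑ m ∈ Finset.range (j + 1), b m ≤ ∑ m ∈ Finset.range n, b m :=
      Finset.sum_le_sum_of_subset_of_nonneg
            (Finset.range_subset_range.2 (by omega)) fun m _ _ => hb0 m
    have e5 : ∑ k ∈ Finset.range n, ‖(inner ℂ (U^[j] v) (U^[k] v) : ℂ)‖ =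
        ∑ k ∈ Finset.range (j + 1), ‖(inner ℂ (U^[j] v) (U^[k] v) : ℂ)‖ +
        ∑ k ∈ Finset.range r, ‖(inner ℂ (U^[j] v) (U^[j + 1 + k] v) : ℂ)‖ := by
      conv_lhs => rw [hr]
      rw [Finset.sum_range_add]
    rw [e5, e1, e2]
    linarith
  have hsq : ‖∑ k ∈ Finset.range n, c k • (U^[k] v)‖ ^ 2 ≤
      n * (M ^ 2 * (2 * ∑ m ∈ Finset.range n, b m)) := by
    have h1 : ‖∑ k ∈ Finset.range n, c k • (U^[k] v)‖ ^ 2 =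
        ‖(inner ℂ (∑ k ∈ Finset.range n, c k • (U^[k] v)) (∑ k ∈ Finset.range n, c k • (U^[k] v)) : ℂ)‖ := by
      rw [inner_self_eq_norm_sq_to_K]; simp
    rw [h1, sum_inner]
    refine (norm_sum_le _ _).trans ?_
    calc _ ≤ ∑ j ∈ Finset.range n, M ^ 2 * (2 * ∑ m ∈ Finset.range n, b m) := by
          refine Finset.sum_le_sum fun j hj => ?_
          rw [inner_sum]
          refine (norm_sum_le _ _).trans ?_
          calc _ ≤ ∑ k ∈ Finset.range n, M ^ 2 * ‖(inner ℂ (U^[j] v) (U^[k] v) : ℂ)‖ := by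
                refine Finset.sum_le_sum fun k hk => ?_
                rw [inner_smul_left, inner_smul_right, norm_mul, norm_mul, RCLike.norm_conj, ← mul_assoc]
                gcongr
                rw [sq]
                gcongr <;> apply hc
            _ ≤ _ := by
                rw [← Finset.mul_sum]
                gcongr
                exact hrow j hj
      _ = _ := by simp
  have hcs : (n : ℝ)⁻¹ * ∑ m ∈ Finset.range n, b m ≤ √((n : ℝ)⁻¹ * ∑ k ∈ Finset.range n, b k ^ 2) := by
    apply Real.le_sqrt_of_sq_le
    have := sq_sum_le_card_mul_sum_sq (s := Finset.range n) (f := b)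
    rw [Finset.card_range] at this
    calc _ = ((n : ℝ)⁻¹) ^ 2 * (∑ m ∈ Finset.range n, b m) ^ 2 := by ring
      _ ≤ ((n : ℝ)⁻¹) ^ 2 * (n * ∑ m ∈ Finset.range n, b m ^ 2) := by gcongr
      _ = _ := by field_simp
  have hfin : ((n : ℝ)⁻¹ * ‖∑ k ∈ Finset.range n, c k • (U^[k] v)‖) ^ 2 ≤
      (M * √(2 * √((n : ℝ)⁻¹ * ∑ k ∈ Finset.range n, b k ^ 2))) ^ 2 := by
    rw [mul_pow, mul_pow, Real.sq_sqrt (by positivity)]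
    calc _ ≤ ((n : ℝ)⁻¹) ^ 2 * (n * (M ^ 2 * (2 * ∑ m ∈ Finset.range n, b m))) := by gcongr
      _ = M ^ 2 * (2 * ((n : ℝ)⁻¹ * ∑ m ∈ Finset.range n, b m)) := by field_simp
      _ ≤ _ := by gcongr
  exact (le_abs_self _).trans (abs_le_of_sq_le_sq hfin (by positivity))

lemma crit [CompleteSpace H] (U : H →ₗᵢ[ℂ] H) (hU : Function.Surjective U) (G : H) (M : ℝ) (hM : 0 ≤ M)
    (hG : ∀ δ : ℝ, 0 < δ → ∃ K : ℕ, ∃ᶠ n : ℕ in atTop, ∃ j ≤ K, ∃ (e : Fin j → H) (c : ℕ → Fin j → ℂ),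
      (∀ i, ‖e i‖ ≤ 1) ∧ (∀ k i, ‖c k i‖ ≤ M) ∧
      (n : ℝ)⁻¹ * ∑ k ∈ Finset.range n, ‖U^[k] G - ∑ i, c k i • e i‖ ^ 2 ≤ δ)
    (v : H) (hv : ∀ (c : ℂ) (u : H), U u = c • u → inner ℂ u v = 0) :
    inner ℂ v G = 0 := by
  obtain ⟨η, hη, hηb⟩ := vdc U hU v hv
  have key : ∀ δ : ℝ, 0 < δ → ‖(inner ℂ v G : ℂ)‖ ≤ ‖v‖ * δ + δ := by
    intro δ hδ
    obtain ⟨K, hK⟩ := hG (δ ^ 2) (by positivity)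
    have hev : ∀ᶠ n in atTop, K * (M * |η n|) < δ := by
      have : Tendsto (fun n => K * (M * |η n|)) atTop (𝓝 0) := by
        simpa using (hη.abs.const_mul M).const_mul (K : ℝ)
      exact this.eventually (gt_mem_nhds hδ)
    obtain ⟨n, ⟨j, hj, e, c, he, hc, hle⟩, hηn, hn⟩ := (hK.and_eventually (hev.and (eventually_gt_atTop 0))).exists
    have hn' : (0 : ℝ) < n := by exact_mod_cast hn
    set h : ℕ → H := fun k => ∑ i, c k i • e i with hh
    have e1 : (n : ℂ) * inner ℂ v G = ∑ k ∈ Finset.range n, inner ℂ (U^[k] v) (U^[k] G - h k)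
        + ∑ k ∈ Finset.range n, inner ℂ (U^[k] v) (h k) := by
      rw [← Finset.sum_add_distrib]
      have : ∀ k ∈ Finset.range n, (inner ℂ (U^[k] v) (U^[k] G - h k) + inner ℂ (U^[k] v) (h k) : ℂ)
          = inner ℂ v G := by
        intro k _
        rw [← inner_add_right, sub_add_cancel, inner_iter]
      rw [Finset.sum_congr rfl this]
      simp
    have e2 : ‖∑ k ∈ Finset.range n, (inner ℂ (U^[k] v) (U^[k] G - h k) : ℂ)‖ ≤ n * (‖v‖ * δ) := by
      calc _ ≤ ∑ k ∈ Finset.range n, ‖v‖ * ‖U^[k] G - h k‖ := by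
            refine (norm_sum_le _ _).trans (Finset.sum_le_sum fun k _ => ?_)
            rw [← norm_iter U k v]
            exact norm_inner_le_norm _ _
        _ = ‖v‖ * ∑ k ∈ Finset.range n, ‖U^[k] G - h k‖ := by rw [Finset.mul_sum]
        _ ≤ ‖v‖ * (n * δ) := by
            gcongr
            have h1 := sq_sum_le_card_mul_sum_sq (s := Finset.range n) (f := fun k => ‖U^[k] G - h k‖)
            rw [Finset.card_range] at h1
            have h2 : ∑ k ∈ Finset.range n, ‖U^[k] G - h k‖ ^ 2 ≤ n * δ ^ 2 := by
              rwa [inv_mul_le_iff₀ hn'] at hle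
            have h3 : (∑ k ∈ Finset.range n, ‖U^[k] G - h k‖) ^ 2 ≤ (n * δ) ^ 2 := by
              calc _ ≤ _ := h1
                _ ≤ n * (n * δ ^ 2) := by gcongr
                _ = _ := by ring
            exact (le_abs_self _).trans (abs_le_of_sq_le_sq h3 (by positivity))
        _ = _ := by ring
    have e3 : ‖∑ k ∈ Finset.range n, (inner ℂ (U^[k] v) (h k) : ℂ)‖ ≤ n * δ := by
      have h1 : ∑ k ∈ Finset.range n, (inner ℂ (U^[k] v) (h k) : ℂ) =
          ∑ i, inner ℂ (∑ k ∈ Finset.range n, (starRingEnd ℂ (c k i)) • (U^[k] v)) (e i) := by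
        simp only [hh, inner_sum, sum_inner, inner_smul_left, inner_smul_right, Complex.conj_conj]
        rw [Finset.sum_comm]
      rw [h1]
      calc _ ≤ ∑ i : Fin j, n * (M * |η n|) := by
            refine (norm_sum_le _ _).trans (Finset.sum_le_sum fun i _ => ?_)
            refine (norm_inner_le_norm _ _).trans ?_
            have h2 := hηb n M (fun k => starRingEnd ℂ (c k i)) hM (fun k => by simpa using hc k i)
            rw [inv_mul_le_iff₀ hn'] at h2
            calc _ ≤ ‖∑ k ∈ Finset.range n, (starRingEnd ℂ (c k i)) • (U^[k] v)‖ * 1 := by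
                  gcongr; exact he i
              _ ≤ n * (M * η n) := by rw [mul_one]; exact h2
              _ ≤ _ := by gcongr; exact le_abs_self _
        _ = n * (j * (M * |η n|)) := by simp; ring
        _ ≤ n * (K * (M * |η n|)) := by gcongr
        _ ≤ _ := by gcongr
    have e4 : n * ‖(inner ℂ v G : ℂ)‖ ≤ n * (‖v‖ * δ + δ) := by
      calc _ = ‖(n : ℂ) * inner ℂ v G‖ := by simp
        _ ≤ _ := by rw [e1]; exact norm_add_le _ _
        _ ≤ n * (‖v‖ * δ) + n * δ := add_le_add e2 e3
        _ = _ := by ring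
    exact le_of_mul_le_mul_left e4 hn'
  have hlim : Tendsto (fun δ : ℝ => ‖v‖ * δ + δ) (𝓝[>] 0) (𝓝 0) := by
    have : Continuous (fun δ : ℝ => ‖v‖ * δ + δ) := by fun_prop
    have h := this.tendsto 0
    simp only [mul_zero, add_zero] at h
    exact h.mono_left nhdsWithin_le_nhds
  have := ge_of_tendsto hlim (eventually_mem_nhdsWithin.mono fun δ hδ => key δ hδ)
  exact norm_le_zero_iff.1 this

lemma eigen_basis [CompleteSpace H] [TopologicalSpace.SeparableSpace H] (U : H →ₗᵢ[ℂ] H)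
    (htot : ∀ v : H, (∀ (c : ℂ) (u : H), U u = c • u → inner ℂ u v = 0) → v = 0) :
    ∃ (ι : Type) (b : HilbertBasis ι ℂ H), ∀ i, ∃ c : ℂ, U (b i) = c • b i := by
  let E : ℂ → Submodule ℂ H := fun c => Module.End.eigenspace U.toLinearMap c
  have hE : ∀ c u, u ∈ E c ↔ U u = c • u := fun c u => Module.End.mem_eigenspace_iff
  have hclosed : ∀ c, IsClosed (E c : Set H) := by
    intro c
    have : (E c : Set H) = {u | U u = c • u} := by ext u; exact hE c u
    rw [this]
    exact isClosed_eq U.continuous (continuous_const_smul c)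
  have hcompl : ∀ c, CompleteSpace (E c) := fun c => (hclosed c).completeSpace_coe
  have horth : OrthogonalFamily ℂ (fun c => E c) fun c => (E c).subtypeₗᵢ := by
    intro c d hcd x y
    show inner ℂ (x : H) (y : H) = 0
    by_contra hne
    have hx0 : (x : H) ≠ 0 := fun h => hne (by rw [h, inner_zero_left])
    have hx := (hE c x).1 x.2
    have hy := (hE d y).1 y.2
    have hcn : ‖c‖ = 1 := by
      have h := U.norm_map (x : H)
      rw [hx, norm_smul] at h
      have := norm_pos_iff.2 hx0
      exact mul_right_cancel₀ this.ne' (by rw [h, one_mul])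
    have h := U.inner_map_map (x : H) (y : H)
    rw [hx, hy, inner_smul_left, inner_smul_right, ← mul_assoc] at h
    have h1 : (starRingEnd ℂ) c * d = 1 := mul_right_cancel₀ hne (by rw [h, one_mul])
    have h2 : c * (starRingEnd ℂ) c = 1 := by
      rw [Complex.mul_conj, Complex.normSq_eq_norm_sq, hcn]; simp
    apply hcd
    calc c = c * ((starRingEnd ℂ) c * d) := by rw [h1, mul_one]
      _ = d := by rw [← mul_assoc, h2, one_mul]
  choose S bS hbS using fun c => exists_hilbertBasis ℂ (E c)
  have hon := horth.orthonormal_sigma_orthonormal (fun c => (bS c).orthonormal)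
  set f : (Σ c, S c) → H := fun a => (E a.1).subtypeₗᵢ (bS a.1 a.2) with hf
  have hcount : Countable (Σ c, S c) := by
    refine Pairwise.countable_of_isOpen_disjoint (s := fun a => Metric.ball (f a) (1 / 2)) ?_
      (fun _ => Metric.isOpen_ball) (fun a => ⟨f a, by simp⟩)
    intro a a' haa
    apply Metric.ball_disjoint_ball
    have h1 : ‖f a - f a'‖ ^ 2 = 2 := by
      have := norm_sub_sq (𝕜 := ℂ) (f a) (f a')
      rw [hon.2 haa, hon.1, hon.1] at this
      rw [this]; norm_num
    rw [dist_eq_norm]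
    nlinarith [norm_nonneg (f a - f a')]
  obtain ⟨g, hg⟩ := hcount.exists_injective_nat
  let eq := Equiv.ofInjective g hg
  have hon' : Orthonormal ℂ (f ∘ eq.symm) := hon.comp _ eq.symm.injective
  have hbot : (Submodule.span ℂ (Set.range (f ∘ eq.symm)))ᗮ = ⊥ := by
    rw [eq.symm.surjective.range_comp, Submodule.eq_bot_iff]
    intro v hv
    refine htot v fun c u hu => ?_
    have hzero : (E c).orthogonalProjectionOnto v = 0 := by
      have h1 : (E c).orthogonalProjectionOnto v ∈ (Submodule.span ℂ (Set.range (bS c)))ᗮ := by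
        rw [Submodule.mem_orthogonal]
        intro y hy
        induction hy using Submodule.span_induction with
        | mem y hy =>
          obtain ⟨i, rfl⟩ := hy
          rw [Submodule.inner_orthogonalProjectionOnto_eq_of_mem_left]
          exact (Submodule.mem_orthogonal _ _).1 hv _ (Submodule.subset_span ⟨⟨c, i⟩, rfl⟩)
        | zero => simp
        | add x y _ _ hx hy => rw [inner_add_left, hx, hy, add_zero]
        | smul a x _ hx => rw [inner_smul_left, hx, mul_zero]
      have h2 := (Submodule.topologicalClosure_eq_top_iff).1 (bS c).dense_span
      rw [h2] at h1
      simpa using h1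
    have := Submodule.inner_orthogonalProjectionOnto_eq_of_mem_left (K := E c) ⟨u, (hE c u).2 hu⟩ v
    rw [hzero, inner_zero_right] at this
    exact this.symm
  refine ⟨_, HilbertBasis.mkOfOrthogonalEqBot hon' hbot, fun i => ?_⟩
  rw [HilbertBasis.coe_mkOfOrthogonalEqBot]
  exact ⟨(eq.symm i).1, (hE _ _).1 (bS (eq.symm i).1 (eq.symm i).2).2⟩

end Hilb

section Meas

/-- Bounded measurable functions whose orbit variation is controlled by the averaged semimetric. -/
def LipAvg (T : Equiv.Perm X) (ρ : X → X → ℝ) (g : X → ℝ) : Prop :=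
  Measurable g ∧ (∃ M : ℝ, 0 ≤ M ∧ ∀ x, |g x| ≤ M) ∧ ∃ C c : ℝ, 0 ≤ C ∧ 0 ≤ c ∧ ∀ (n : ℕ) (x y : X),
    ∑ k ∈ Finset.range n, |g ((T ^ k) x) - g ((T ^ k) y)| ≤
      C * ∑ k ∈ Finset.range n, ρ ((T ^ k) x) ((T ^ k) y) + c

lemma LipAvg.base {T : Equiv.Perm X} {ρ : X → X → ℝ} (hρ : IsSemimetric ρ)
    (hm : Measurable (fun p : X × X => ρ p.1 p.2)) (a : X) :
    LipAvg T ρ (fun x => min (ρ x a) 1) := by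
  refine ⟨(hm.comp (measurable_id.prodMk measurable_const)).min measurable_const,
    ⟨1, zero_le_one, fun x => ?_⟩, 1, 0, zero_le_one, le_rfl, fun n x y => ?_⟩
  · rw [abs_of_nonneg (le_min (hρ.nonneg _ _) zero_le_one)]
    exact min_le_right _ _
  · rw [one_mul, add_zero]
    refine Finset.sum_le_sum fun k _ => ?_
    have h1 := hρ.triangle ((T ^ k) x) ((T ^ k) y) a
    have h2 := hρ.triangle ((T ^ k) y) ((T ^ k) x) a
    rw [hρ.symm ((T ^ k) y) ((T ^ k) x)] at h2
    have h3 := hρ.nonneg ((T ^ k) x) ((T ^ k) y)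
    rw [abs_le]
    constructor <;> (rcases min_cases (ρ ((T ^ k) x) a) 1 with h | h <;> rcases min_cases (ρ ((T ^ k) y) a) 1 with h' | h' <;> linarith)

lemma LipAvg.lip {T : Equiv.Perm X} {ρ : X → X → ℝ} (hρ : IsSemimetric ρ) {g : X → ℝ}
    (hg : LipAvg T ρ g) (φ : ℝ → ℝ) (hφm : Measurable φ) (L : ℝ) (hL : 0 ≤ L)
    (hφ : ∀ s t, |φ s - φ t| ≤ L * |s - t|) : LipAvg T ρ (fun x => φ (g x)) := by
  obtain ⟨hgm, ⟨M, hM, hgM⟩, C, c, hC, hc, h⟩ := hg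
  refine ⟨hφm.comp hgm, ⟨|φ 0| + L * M, by positivity, fun x => ?_⟩, L * C, L * c, by positivity,
    by positivity, fun n x y => ?_⟩
  · have h1 := hφ (g x) 0
    rw [sub_zero] at h1
    have h2 : L * |g x| ≤ L * M := by gcongr; exact hgM x
    have h3 := abs_sub_abs_le_abs_sub (φ (g x)) (φ 0)
    linarith
  · calc _ ≤ ∑ k ∈ Finset.range n, L * |g ((T ^ k) x) - g ((T ^ k) y)| :=
          Finset.sum_le_sum fun k _ => hφ _ _
      _ = L * ∑ k ∈ Finset.range n, |g ((T ^ k) x) - g ((T ^ k) y)| := by rw [Finset.mul_sum]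
      _ ≤ L * (C * ∑ k ∈ Finset.range n, ρ ((T ^ k) x) ((T ^ k) y) + c) := by gcongr; exact h n x y
      _ = _ := by ring

lemma LipAvg.mul {T : Equiv.Perm X} {ρ : X → X → ℝ} {g g' : X → ℝ}
    (hg : LipAvg T ρ g) (hg' : LipAvg T ρ g') : LipAvg T ρ (fun x => g x * g' x) := by
  obtain ⟨hgm, ⟨M, hM, hgM⟩, C, c, hC, hc, h⟩ := hg
  obtain ⟨hgm', ⟨M', hM', hgM'⟩, C', c', hC', hc', h'⟩ := hg'
  refine ⟨hgm.mul hgm', ⟨M * M', by positivity, fun x => ?_⟩, M' * C + M * C', M' * c + M * c',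
    by positivity, by positivity, fun n x y => ?_⟩
  · rw [abs_mul]
    gcongr
    · exact hgM x
    · exact hgM' x
  · calc _ ≤ ∑ k ∈ Finset.range n, (M' * |g ((T ^ k) x) - g ((T ^ k) y)| +
            M * |g' ((T ^ k) x) - g' ((T ^ k) y)|) := by
          refine Finset.sum_le_sum fun k _ => ?_
          set x' := (T ^ k) x
          set y' := (T ^ k) y
          have : g x' * g' x' - g y' * g' y' = g' x' * (g x' - g y') + g y' * (g' x' - g' y') := by ring
          rw [this]
          refine (abs_add_le _ _).trans ?_
          rw [abs_mul, abs_mul]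
          gcongr
          · exact hgM' _
          · exact hgM _
      _ = M' * ∑ k ∈ Finset.range n, |g ((T ^ k) x) - g ((T ^ k) y)| +
          M * ∑ k ∈ Finset.range n, |g' ((T ^ k) x) - g' ((T ^ k) y)| := by
          rw [Finset.sum_add_distrib, Finset.mul_sum, Finset.mul_sum]
      _ ≤ M' * (C * ∑ k ∈ Finset.range n, ρ ((T ^ k) x) ((T ^ k) y) + c) +
          M * (C' * ∑ k ∈ Finset.range n, ρ ((T ^ k) x) ((T ^ k) y) + c') := by
          gcongr
          · exact h n x y
          · exact h' n x y
      _ = _ := by ring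

lemma LipAvg.const {T : Equiv.Perm X} {ρ : X → X → ℝ} (hρ : IsSemimetric ρ) (a : ℝ) :
    LipAvg T ρ (fun _ => a) := by
  refine ⟨measurable_const, ⟨|a|, abs_nonneg _, fun x => le_rfl⟩, 0, 0, le_rfl, le_rfl, fun n x y => ?_⟩
  simp

lemma LipAvg.shift {T : Equiv.Perm X} {ρ : X → X → ℝ} (hT : Measurable T) {g : X → ℝ}
    (hg : LipAvg T ρ g) : LipAvg T ρ (fun x => g (T x)) := by
  obtain ⟨hgm, ⟨M, hM, hgM⟩, C, c, hC, hc, h⟩ := hg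
  refine ⟨hgm.comp hT, ⟨M, hM, fun x => hgM _⟩, C, c + 2 * M, hC, by positivity, fun n x y => ?_⟩
  have hstep : ∀ (k : ℕ) (z : X), T ((T ^ k) z) = (T ^ (k + 1)) z := by
    intro k z; rw [pow_succ']; rfl
  simp only [hstep]
  have h1 := Finset.sum_range_succ' (fun k => |g ((T ^ k) x) - g ((T ^ k) y)|) n
  have h2 := Finset.sum_range_succ (fun k => |g ((T ^ k) x) - g ((T ^ k) y)|) n
  have h3 := h n x y
  have h4 : |g ((T ^ n) x) - g ((T ^ n) y)| ≤ 2 * M := by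
    have := abs_sub (g ((T ^ n) x)) (g ((T ^ n) y))
    linarith [hgM ((T ^ n) x), hgM ((T ^ n) y)]
  have h5 := abs_nonneg (g ((T ^ 0) x) - g ((T ^ 0) y))
  linarith

lemma LipAvg.shiftSymm {T : Equiv.Perm X} {ρ : X → X → ℝ} (hρ : IsSemimetric ρ)
    (hT : Measurable T.symm) {g : X → ℝ}
    (hg : LipAvg T ρ g) : LipAvg T ρ (fun x => g (T.symm x)) := by
  obtain ⟨hgm, ⟨M, hM, hgM⟩, C, c, hC, hc, h⟩ := hg
  refine ⟨hgm.comp hT, ⟨M, hM, fun x => hgM _⟩, C, c + 2 * M, hC, by positivity, fun n x y => ?_⟩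
  rcases n with _ | n
  · simp; positivity
  have hstep : ∀ (k : ℕ) (z : X), T.symm ((T ^ (k + 1)) z) = (T ^ k) z := by
    intro k z; rw [pow_succ']; simp
  rw [Finset.sum_range_succ', Finset.sum_range_succ]
  simp only [hstep]
  have h3 := h n x y
  have h4 : |g (T.symm ((T ^ 0) x)) - g (T.symm ((T ^ 0) y))| ≤ 2 * M := by
    have := abs_sub (g (T.symm ((T ^ 0) x))) (g (T.symm ((T ^ 0) y)))
    linarith [hgM (T.symm ((T ^ 0) x)), hgM (T.symm ((T ^ 0) y))]
  have h5 := mul_nonneg hC (hρ.nonneg ((T ^ n) x) ((T ^ n) y))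
  linarith

lemma LipAvg.shiftInt {T : Equiv.Perm X} {ρ : X → X → ℝ} (hρ : IsSemimetric ρ)
    (hT : Measurable T) (hT' : Measurable T.symm) {g : X → ℝ}
    (hg : LipAvg T ρ g) (k : ℤ) : LipAvg T ρ (fun x => g ((T ^ k) x)) := by
  induction k using Int.induction_on with
  | zero => simpa using hg
  | succ i ih =>
    have := ih.shift hT
    convert this using 3 with x
    rw [zpow_add_one]; rfl
  | pred i ih =>
    have := ih.shiftSymm hρ hT'
    convert this using 3 with x
    rw [zpow_sub_one]; rfl

lemma entropy_bound_s10 {μ : Measure X} {T : Equiv.Perm X} {ρ : X → X → ℝ}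
    (h : IsScalingSeq μ T ρ (fun _ => 1)) (ε : ℝ) (hε : 0 < ε) :
    ∃ K : ℕ, ∀ᶠ n : ℕ in atTop, ∃ j ≤ K, IsEntropyPartition μ (avgSemimetric T ρ n) ε j := by
  obtain ⟨b, hb1, hb2⟩ := exists_between (h.2.1 ε hε)
  refine ⟨⌈(2 : ℝ) ^ b.toReal⌉₊, (eventually_lt_of_limsup_lt hb1).mono fun n hn => ?_⟩
  simp only [ENNReal.ofReal_one, div_one] at hn
  classical
  unfold epsEntropy at hn
  split_ifs at hn with hex
  · refine ⟨Nat.find hex, ?_, Nat.find_spec hex⟩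
    have h1 : Real.logb 2 (Nat.find hex : ℕ) ≤ b.toReal := 
      (ENNReal.ofReal_le_iff_le_toReal hb2.ne).1 hn.le
    rcases Nat.eq_zero_or_pos (Nat.find hex) with h0 | h0
    · rw [h0]; exact Nat.zero_le _
    · have h2 : ((Nat.find hex : ℕ) : ℝ) ≤ (2 : ℝ) ^ b.toReal := by
        rwa [Real.logb_le_iff_le_rpow (by norm_num) (by exact_mod_cast h0)] at h1
      exact_mod_cast h2.trans (Nat.le_ceil _)
  · exact absurd hn (by simp)

end Meas

section MeasTwo
variable {X : Type*} [MeasurableSpace X]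

lemma L2_norm_sq {μ : Measure X} (f : Lp ℂ 2 μ) : ‖f‖ ^ 2 = ∫ x, ‖f x‖ ^ 2 ∂μ := by
  have h := inner_self_eq_norm_sq_to_K (𝕜 := ℂ) f
  rw [L2.inner_def] at h
  have h2 : ∀ x, inner ℂ (f x) (f x) = ((‖f x‖ ^ 2 : ℝ) : ℂ) := by
    intro x; rw [inner_self_eq_norm_sq_to_K]; push_cast; rfl
  simp_rw [h2] at h
  rw [integral_complex_ofReal] at h
  have h3 : ((∫ x, ‖f x‖ ^ 2 ∂μ : ℝ) : ℂ) = ((‖f‖ ^ 2 : ℝ) : ℂ) := by rw [h]; push_cast; rfl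
  exact (Complex.ofReal_injective h3).symm

lemma memLp_real {μ : Measure X} [IsProbabilityMeasure μ] {g : X → ℝ} (hg : Measurable g)
    (M : ℝ) (hM : ∀ x, |g x| ≤ M) : MemLp (fun x => (g x : ℂ)) 2 μ :=
  MemLp.of_bound (Complex.measurable_ofReal.comp hg).aestronglyMeasurable M
    (Eventually.of_forall fun x => by simpa using hM x)

lemma iter_toLp {μ : Measure X} [IsProbabilityMeasure μ] {T : Equiv.Perm X}
    (hT : MeasurePreserving T μ μ) {g : X → ℝ} 
    (hm : MemLp (fun x => (g x : ℂ)) 2 μ) (k : ℕ) :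
    ((Lp.compMeasurePreservingₗᵢ ℂ T hT)^[k] (hm.toLp _) : Lp ℂ 2 μ) =ᵐ[μ]
      fun x => (g ((T ^ k) x) : ℂ) := by
  have h : (Lp.compMeasurePreservingₗᵢ ℂ T hT)^[k] (hm.toLp _)
      = Lp.compMeasurePreserving (T^[k]) (hT.iterate k) (hm.toLp _) := by
    rw [← Lp.compMeasurePreserving_iterate]; rfl
  rw [h, Lp.toLp_compMeasurePreserving hm (hT.iterate k)]
  refine (MemLp.coeFn_toLp _).trans (Eventually.of_forall fun x => ?_)
  simp [Equiv.Perm.iterate_eq_pow]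

lemma approx_bound {μ : Measure X} [IsProbabilityMeasure μ] {T : Equiv.Perm X} {ρ : X → X → ℝ}
    (hT : MeasurePreserving T μ μ) {g : X → ℝ} (hgm : Measurable g) (M C c : ℝ)
    (hM : 0 ≤ M) (hC : 0 ≤ C) (hc : 0 ≤ c) (hgM : ∀ x, |g x| ≤ M)
    (h : ∀ (n : ℕ) (x y : X),
      ∑ k ∈ Finset.range n, |g ((T ^ k) x) - g ((T ^ k) y)| ≤
      C * ∑ k ∈ Finset.range n, ρ ((T ^ k) x) ((T ^ k) y) + c)
    (hm : MemLp (fun x => (g x : ℂ)) 2 μ) (n : ℕ) (hn : 0 < n) (ε : ℝ) (hε : 0 < ε) (j : ℕ)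
    (hP : IsEntropyPartition μ (avgSemimetric T ρ n) ε j) :
    ∃ (e : Fin (j + 1) → Lp ℂ 2 μ) (d : ℕ → Fin (j + 1) → ℂ), (∀ i, ‖e i‖ ≤ 1) ∧
      (∀ k i, ‖d k i‖ ≤ M) ∧
      (n:ℝ)⁻¹ * ∑ k ∈ Finset.range n, ‖(Lp.compMeasurePreservingₗᵢ ℂ T hT)^[k] (hm.toLp _)
        - ∑ i, d k i • e i‖^2 ≤ 2 * M * (C * ε + c / n) + 4 * M ^ 2 * ε := by
  obtain ⟨P, hPm, hPd, hPu, hP0, hPε⟩ := hP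
  have hne : Nonempty X := (inferInstance : NeZero μ).out |> fun h => by
    by_contra hX
    rw [not_nonempty_iff] at hX
    exact h (Measure.eq_zero_of_isEmpty μ)
  have hr : ∃ r : Fin (j + 1) → X, ∀ i, (P i).Nonempty → r i ∈ P i := by
    classical
    refine ⟨fun i => if hi : (P i).Nonempty then hi.some else hne.some, fun i hi => ?_⟩
    simp only [hi, dite_true]; exact hi.some_mem
  obtain ⟨r, hr⟩ := hr
  refine ⟨fun i => indicatorConstLp 2 (hPm i) (measure_ne_top μ _) (1 : ℂ),
    fun k i => (g ((T ^ k) (r i)) : ℂ), fun i => ?_, fun k i => by simpa using hgM _, ?_⟩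
  · refine norm_indicatorConstLp_le.trans ?_
    have : μ.real (P i) ≤ 1 := measureReal_le_one
    simpa using Real.rpow_le_one (by positivity) this (by norm_num)
  set e : Fin (j + 1) → Lp ℂ 2 μ := fun i => indicatorConstLp 2 (hPm i) (measure_ne_top μ _) (1 : ℂ)
    with he
  have hTk : ∀ k : ℕ, Measurable (⇑(T ^ k)) := by
    intro k
    rw [← Equiv.Perm.iterate_eq_pow]; exact hT.measurable.iterate k
  -- piece index
  have hidx : ∀ x, ∃ i, x ∈ P i := fun x => by
    have : x ∈ ⋃ j, P j := hPu ▸ mem_univ x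
    simpa using this
  choose ix hix using hidx
  let w : ℕ → X → ℝ := fun k x => g ((T ^ k) x) - ∑ i, g ((T ^ k) (r i)) * (P i).indicator 1 x
  have hwx : ∀ k x, w k x = g ((T ^ k) x) - g ((T ^ k) (r (ix x))) := by
    intro k x
    simp only [w]
    rw [Finset.sum_eq_single (ix x)]
    · simp [indicator_of_mem (hix x)]
    · intro i _ hi
      have : x ∉ P i := fun hxi => (Set.disjoint_left.1 (hPd hi) hxi (hix x))
      simp [this]
    · simp
  have hwm : ∀ k, Measurable (w k) := by
    intro k
    refine (hgm.comp (hTk k)).sub (Finset.measurable_sum _ fun i _ => ?_)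
    exact measurable_const.mul (measurable_one.indicator (hPm i))
  have hwM : ∀ k x, |w k x| ≤ 2 * M := by
    intro k x
    rw [hwx]
    have := abs_sub (g ((T ^ k) x)) (g ((T ^ k) (r (ix x))))
    linarith [hgM ((T ^ k) x), hgM ((T ^ k) (r (ix x)))]
  have hae : ∀ k, ((Lp.compMeasurePreservingₗᵢ ℂ T hT)^[k] (hm.toLp _)
        - ∑ i, (g ((T ^ k) (r i)) : ℂ) • e i : Lp ℂ 2 μ) =ᵐ[μ] fun x => (w k x : ℂ) := by
    intro k
    have h3 : ∀ᵐ x ∂μ, ∀ i, ((g ((T ^ k) (r i)) : ℂ) • e i : Lp ℂ 2 μ) x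
        = (g ((T ^ k) (r i)) : ℂ) * (P i).indicator (fun _ => (1:ℂ)) x := by
      rw [ae_all_iff]
      intro i
      filter_upwards [Lp.coeFn_smul (g ((T ^ k) (r i)) : ℂ) (e i),
        indicatorConstLp_coeFn (p := 2) (hs := hPm i) (hμs := measure_ne_top μ _) (c := (1:ℂ))]
        with x h1 h2
      rw [h1, Pi.smul_apply, smul_eq_mul, he, h2]
    filter_upwards [Lp.coeFn_sub ((Lp.compMeasurePreservingₗᵢ ℂ T hT)^[k] (hm.toLp _))
      (∑ i, (g ((T ^ k) (r i)) : ℂ) • e i), iter_toLp hT hm k, h3,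
      Lp.coeFn_finsetSum Finset.univ (fun i => (g ((T ^ k) (r i)) : ℂ) • e i)] with x h1 h2 h3 h4
    rw [h1, Pi.sub_apply, h2, h4, Finset.sum_apply]
    simp only [w]
    rw [Complex.ofReal_sub, Complex.ofReal_sum]
    congr 1
    refine Finset.sum_congr rfl fun i _ => ?_
    rw [h3 i, Complex.ofReal_mul]
    congr 1
    by_cases hxi : x ∈ P i <;> simp [hxi]
  have hns : ∀ k, ‖(Lp.compMeasurePreservingₗᵢ ℂ T hT)^[k] (hm.toLp _)
        - ∑ i, (g ((T ^ k) (r i)) : ℂ) • e i‖ ^ 2 = ∫ x, (w k x) ^ 2 ∂μ := by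
    intro k
    rw [L2_norm_sq]
    refine integral_congr_ae ?_
    filter_upwards [hae k] with x hx
    simp only [hx]
    simp
  simp_rw [hns]
  have hwint : ∀ k, Integrable (fun x => (w k x) ^ 2) μ := by
    intro k
    refine Integrable.of_bound ((hwm k).pow_const 2).aestronglyMeasurable ((2 * M) ^ 2)
      (Eventually.of_forall fun x => ?_)
    rw [Real.norm_eq_abs, abs_pow]
    gcongr
    exact hwM k x
  rw [← integral_finsetSum _ (fun k _ => hwint k), ← integral_const_mul]
  have hn' : (0:ℝ) < n := by exact_mod_cast hn
  have hpt : ∀ x, (n:ℝ)⁻¹ * ∑ k ∈ Finset.range n, (w k x) ^ 2 ≤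
      2 * M * (C * ε + c / n) + (P 0).indicator (fun _ => 4 * M ^ 2) x := by
    intro x
    by_cases h0 : ix x = 0
    · have hx0 : x ∈ P 0 := h0 ▸ hix x
      rw [indicator_of_mem hx0]
      have : ∑ k ∈ Finset.range n, (w k x) ^ 2 ≤ ∑ k ∈ Finset.range n, 4 * M ^ 2 := by
        refine Finset.sum_le_sum fun k _ => ?_
        have := hwM k x
        rw [← sq_abs]; nlinarith [abs_nonneg (w k x)]
      rw [Finset.sum_const, Finset.card_range, nsmul_eq_mul] at this
      have h5 : (n:ℝ)⁻¹ * ∑ k ∈ Finset.range n, (w k x) ^ 2 ≤ 4 * M ^ 2 := by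
        rw [inv_mul_le_iff₀ hn']; exact this
      have : 0 ≤ 2 * M * (C * ε + c / n) := by positivity
      linarith
    · have hi0 : 0 ≤ (P 0).indicator (fun _ => 4 * M ^ 2) x :=
        indicator_nonneg (fun _ _ => by positivity) _
      have hrx := hPε (ix x) h0 x (hix x) (r (ix x)) (hr _ ⟨x, hix x⟩)
      unfold avgSemimetric at hrx
      rw [div_lt_iff₀ hn'] at hrx
      have h6 := h n x (r (ix x))
      have h7 : ∑ k ∈ Finset.range n, (w k x) ^ 2 ≤
          2 * M * ∑ k ∈ Finset.range n, |g ((T ^ k) x) - g ((T ^ k) (r (ix x)))| := by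
        rw [Finset.mul_sum]
        refine Finset.sum_le_sum fun k _ => ?_
        rw [← hwx, ← sq_abs, sq]
        exact mul_le_mul_of_nonneg_right (hwM k x) (abs_nonneg _)
      have h8 : ∑ k ∈ Finset.range n, (w k x) ^ 2 ≤ 2 * M * (C * (ε * n) + c) := by
        refine h7.trans (mul_le_mul_of_nonneg_left (h6.trans ?_) (by positivity))
        have := mul_le_mul_of_nonneg_left hrx.le hC
        linarith
      have h5 : (n:ℝ)⁻¹ * ∑ k ∈ Finset.range n, (w k x) ^ 2 ≤ 2 * M * (C * ε + c / n) := by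
        rw [inv_mul_le_iff₀ hn']
        refine h8.trans (le_of_eq ?_)
        field_simp
      linarith
  refine (integral_mono ((integrable_finsetSum _ fun k _ => hwint k).const_mul _)
    ((integrable_const _).add ((integrable_const (4 * M ^ 2)).indicator (hPm 0))) hpt).trans ?_
  rw [integral_add' (integrable_const _) ((integrable_const (4 * M ^ 2)).indicator (hPm 0)),
    integral_indicator_const _ (hPm 0)]
  simp only [integral_const, probReal_univ, one_smul, smul_eq_mul]
  have : μ.real (P 0) ≤ ε := by
    rw [Measure.real]
    exact ENNReal.toReal_le_of_le_ofReal hε.le hP0.le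
  nlinarith [mul_le_mul_of_nonneg_right this (by positivity : 0 ≤ 4 * M ^ 2)]

lemma crit_hyp {μ : Measure X} [IsProbabilityMeasure μ] {T : Equiv.Perm X} {ρ : X → X → ℝ}
    (hT : MeasurePreserving T μ μ) (hs : IsScalingSeq μ T ρ (fun _ => 1)) {g : X → ℝ}
    (hgm : Measurable g) (M C c : ℝ)
    (hM : 0 ≤ M) (hC : 0 ≤ C) (hc : 0 ≤ c) (hgM : ∀ x, |g x| ≤ M)
    (h : ∀ (n : ℕ) (x y : X),
      ∑ k ∈ Finset.range n, |g ((T ^ k) x) - g ((T ^ k) y)| ≤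
      C * ∑ k ∈ Finset.range n, ρ ((T ^ k) x) ((T ^ k) y) + c)
    (hm : MemLp (fun x => (g x : ℂ)) 2 μ) (δ : ℝ) (hδ : 0 < δ) :
    ∃ K : ℕ, ∃ᶠ n : ℕ in atTop, ∃ j ≤ K, ∃ (e : Fin j → Lp ℂ 2 μ) (d : ℕ → Fin j → ℂ),
      (∀ i, ‖e i‖ ≤ 1) ∧ (∀ k i, ‖d k i‖ ≤ M) ∧
      (n:ℝ)⁻¹ * ∑ k ∈ Finset.range n, ‖(Lp.compMeasurePreservingₗᵢ ℂ T hT)^[k] (hm.toLp _)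
        - ∑ i, d k i • e i‖^2 ≤ δ := by
  set A : ℝ := 2 * M * C + 4 * M ^ 2 + 1 with hA
  have hA0 : 0 < A := by positivity
  obtain ⟨K, hK⟩ := entropy_bound_s10 hs (δ / (2 * A)) (by positivity)
  refine ⟨K + 1, Eventually.frequently ?_⟩
  have hlim : Tendsto (fun n : ℕ => (2 * M * c) / (n : ℝ)) atTop (nhds 0) :=
    tendsto_const_div_atTop_nhds_zero_nat _
  filter_upwards [hK, eventually_gt_atTop 0, hlim.eventually_lt_const (half_pos hδ)]
    with n ⟨j, hj, hP⟩ hn hl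
  obtain ⟨e, d, h1, h2, h3⟩ := approx_bound hT hgm M C c hM hC hc hgM h hm n hn _ (by positivity) j hP
  refine ⟨j + 1, by omega, e, d, h1, h2, h3.trans ?_⟩
  have h4 : (2 * M * C + 4 * M ^ 2) * (δ / (2 * A)) ≤ δ / 2 := by
    have : A * (δ / (2 * A)) = δ / 2 := by field_simp
    rw [← this]
    gcongr
    linarith
  have h5 : 2 * M * (C * (δ / (2 * A)) + c / n) + 4 * M ^ 2 * (δ / (2 * A))
    = (2 * M * C + 4 * M ^ 2) * (δ / (2 * A)) + 2 * M * c / n := by ring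
  linarith

lemma koopman_surj {μ : Measure X} {T : Equiv.Perm X}
    (hT : MeasurePreserving T μ μ) (hT' : Measurable T.symm) :
    Function.Surjective (Lp.compMeasurePreservingₗᵢ ℂ T hT : Lp ℂ 2 μ →ₗᵢ[ℂ] Lp ℂ 2 μ) := by
  have hs : MeasurePreserving T.symm μ μ :=
    MeasurePreserving.symm (⟨T, hT.measurable, hT'⟩ : X ≃ᵐ X) hT
  intro f
  refine ⟨Lp.compMeasurePreserving T.symm hs f, ?_⟩
  refine Lp.ext ?_
  have h1 := Lp.coeFn_compMeasurePreserving (Lp.compMeasurePreserving T.symm hs f) hT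
  have h2 := hT.quasiMeasurePreserving.ae (Lp.coeFn_compMeasurePreserving f hs)
  filter_upwards [h1, h2] with x h1 h2
  refine h1.trans ?_
  simp only [Function.comp_apply] at h2 ⊢
  rw [h2]; simp

end MeasTwo

section MeasThree
variable {X : Type*} [MeasurableSpace X]

lemma zpow_mp {μ : Measure X} {T : Equiv.Perm X}
    (hT : MeasurePreserving T μ μ) (hT' : Measurable T.symm) (k : ℤ) :
    MeasurePreserving (⇑(T ^ k)) μ μ := by
  have hs : MeasurePreserving T.symm μ μ :=
    MeasurePreserving.symm (⟨T, hT.measurable, hT'⟩ : X ≃ᵐ X) hT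
  induction k using Int.induction_on with
  | zero => simpa using MeasurePreserving.id μ
  | succ i ih => rw [zpow_add_one]; exact ih.comp hT
  | pred i ih => rw [zpow_sub_one]; exact ih.comp hs

/-- Sets whose indicators are pointwise limits of bounded `LipAvg` functions. -/
def LipSets (T : Equiv.Perm X) (ρ : X → X → ℝ) : Set (Set X) :=
  {A | MeasurableSet A ∧ ∃ f : ℕ → X → ℝ, (∀ n, LipAvg T ρ (f n)) ∧ (∀ n x, |f n x| ≤ 1) ∧
    ∀ x, Tendsto (fun n => f n x) atTop (𝓝 (A.indicator 1 x))}

lemma LipSets_inter {T : Equiv.Perm X} {ρ : X → X → ℝ} : IsPiSystem (LipSets T ρ) := by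
  rintro A ⟨hA, f, hf, hf1, hfA⟩ B ⟨hB, g, hg, hg1, hgB⟩ -
  refine ⟨hA.inter hB, fun n x => f n x * g n x, fun n => (hf n).mul (hg n), fun n x => ?_,
    fun x => ?_⟩
  · rw [abs_mul]
    exact mul_le_one₀ (hf1 n x) (abs_nonneg _) (hg1 n x)
  · have := (hfA x).mul (hgB x)
    have h2 : (A ∩ B).indicator (1 : X → ℝ) x = A.indicator 1 x * B.indicator 1 x := by
      by_cases hxA : x ∈ A <;> by_cases hxB : x ∈ B <;> simp [hxA, hxB]
    rw [h2]
    exact this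

lemma LipSets_univ {T : Equiv.Perm X} {ρ : X → X → ℝ} (hρ : IsSemimetric ρ) :
    univ ∈ LipSets T ρ :=
  ⟨MeasurableSet.univ, fun _ _ => 1, fun _ => LipAvg.const hρ 1, fun n x => by simp,
    fun x => by simp⟩

lemma LipSets_Ioi {T : Equiv.Perm X} {ρ : X → X → ℝ} (hρ : IsSemimetric ρ) {g : X → ℝ}
    (hg : LipAvg T ρ g) (t : ℝ) : g ⁻¹' Ioi t ∈ LipSets T ρ := by
  refine ⟨hg.1 measurableSet_Ioi, fun n x => max 0 (min 1 (n * (g x - t))), fun n => ?_,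
    fun n x => ?_, fun x => ?_⟩
  · refine LipAvg.lip hρ hg (fun s => max 0 (min 1 (n * (s - t)))) (by fun_prop) n (by positivity)
      fun s u => ?_
    have h1 := abs_max_sub_max_le_abs (min 1 ((n:ℝ) * (s - t))) (min 1 ((n:ℝ) * (u - t))) 0
    rw [max_comm _ 0, max_comm _ 0] at h1
    have h2 := abs_min_sub_min_le_max 1 ((n:ℝ) * (s - t)) 1 ((n:ℝ) * (u - t))
    refine h1.trans (h2.trans ?_)
    rw [sub_self, abs_zero, max_eq_right (abs_nonneg _), ← mul_sub, abs_mul, Nat.abs_cast]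
    simp
  · rw [abs_of_nonneg (le_max_left _ _)]
    exact max_le zero_le_one (min_le_left _ _)
  · by_cases hx : t < g x
    · have hx' : x ∈ g ⁻¹' Ioi t := hx
      rw [indicator_of_mem hx', Pi.one_apply]
      refine tendsto_const_nhds.congr' ?_
      obtain ⟨N, hN⟩ := exists_nat_gt (1 / (g x - t))
      have h0 : 0 < g x - t := sub_pos.2 hx
      filter_upwards [eventually_ge_atTop N] with n hn
      have h1 : (1:ℝ) ≤ n * (g x - t) := by
        rw [← div_le_iff₀ h0]
        exact hN.le.trans (by exact_mod_cast hn)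
      rw [min_eq_left h1, max_eq_right zero_le_one]
    · have hx' : x ∉ g ⁻¹' Ioi t := hx
      rw [indicator_of_notMem hx']
      refine tendsto_const_nhds.congr fun n => ?_
      have h1 : (n:ℝ) * (g x - t) ≤ 0 :=
        mul_nonpos_of_nonneg_of_nonpos (by positivity) (by linarith [not_lt.1 hx])
      exact (max_eq_left ((min_le_right _ _).trans h1)).symm

lemma LipSets_integral {μ : Measure X} [IsProbabilityMeasure μ]
    {T : Equiv.Perm X} {ρ : X → X → ℝ} (hρ : IsSemimetric ρ)
    {v : X → ℂ} (hv : Integrable v μ)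
    (h : ∀ g, LipAvg T ρ g → ∫ x, (g x : ℂ) * v x ∂μ = 0)
    (A : Set X) (hA : MeasurableSet[MeasurableSpace.generateFrom (LipSets T ρ)] A) :
    MeasurableSet A ∧ ∫ x in A, v x ∂μ = 0 := by
  have hbase : ∀ A ∈ LipSets T ρ, ∫ x in A, v x ∂μ = 0 := by
    rintro A ⟨hA, f, hf, hf1, hfA⟩
    have ht : Tendsto (fun n => ∫ x, (f n x : ℂ) * v x ∂μ) atTop
        (𝓝 (∫ x, A.indicator v x ∂μ)) := by
      refine tendsto_integral_of_dominated_convergence (fun x => ‖v x‖) (fun n => ?_) hv.norm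
        (fun n => ?_) ?_
      · exact ((Complex.measurable_ofReal.comp (hf n).1).aestronglyMeasurable).mul
          hv.aestronglyMeasurable
      · refine Eventually.of_forall fun x => ?_
        rw [norm_mul, Complex.norm_real, Real.norm_eq_abs]
        exact mul_le_of_le_one_left (norm_nonneg _) (hf1 n x)
      · refine Eventually.of_forall fun x => ?_
        have := ((Complex.continuous_ofReal.tendsto _).comp (hfA x)).mul_const (v x)
        have h2 : A.indicator v x = ((A.indicator (1 : X → ℝ) x : ℝ) : ℂ) * v x := by
          by_cases hx : x ∈ A <;> simp [hx]
        rw [h2]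
        exact this
    simp_rw [h _ (hf _)] at ht
    rw [← integral_indicator hA]
    exact (tendsto_nhds_unique ht tendsto_const_nhds)
  have huniv : ∫ x, v x ∂μ = 0 := by
    have := hbase _ (LipSets_univ hρ)
    rwa [setIntegral_univ] at this
  refine MeasurableSpace.induction_on_inter
    (C := fun A _ => MeasurableSet A ∧ ∫ x in A, v x ∂μ = 0) rfl LipSets_inter ?_ ?_ ?_ ?_ A hA
  · simp
  · exact fun A hA => ⟨hA.1, hbase A hA⟩
  · rintro A - ⟨hA, hA0⟩
    refine ⟨hA.compl, ?_⟩
    have := integral_add_compl hA hv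
    rw [hA0, zero_add] at this
    rw [this, huniv]
  · intro f hd _ hf
    refine ⟨MeasurableSet.iUnion fun i => (hf i).1, ?_⟩
    rw [integral_iUnion (fun i => (hf i).1) hd hv.integrableOn]
    simp [(hf _).2]

lemma total_zero [StandardBorelSpace X] {μ : Measure X} [IsProbabilityMeasure μ]
    {T : Equiv.Perm X} {ρ : X → X → ℝ} (hρ : IsSemimetric ρ)
    (hm : Measurable (fun p : X × X => ρ p.1 p.2))
    (hT : MeasurePreserving T μ μ) (hT' : Measurable T.symm)
    (hadm : IsAdmissible μ ρ) (hgen : IsGenerating μ T ρ)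
    {v : X → ℂ} (hv : Integrable v μ)
    (h : ∀ g, LipAvg T ρ g → ∫ x, (g x : ℂ) * v x ∂μ = 0) : v =ᵐ[μ] 0 := by
  obtain ⟨s1, hs1, hs1n, D, hD, hDs, hDd⟩ := hadm
  obtain ⟨s0, hs0, hs0n, hsep⟩ := hgen
  have : Countable D := hD.to_subtype
  let Φ : X → (D × ℤ → ℝ) := fun x q => min (ρ ((T ^ q.2) x) q.1) 1
  have hΦL : ∀ q : D × ℤ, LipAvg T ρ (fun x => Φ x q) := fun q =>
    LipAvg.shiftInt hρ hT.measurable hT' (LipAvg.base hρ hm (q.1 : X)) q.2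
  have hΦm : Measurable Φ := measurable_pi_lambda _ fun q => (hΦL q).1
  have hΦg : Measurable[MeasurableSpace.generateFrom (LipSets T ρ)] Φ := by
    refine @measurable_pi_lambda _ _ _ (MeasurableSpace.generateFrom (LipSets T ρ)) _ _ fun q => ?_
    refine @measurable_of_Ioi ℝ X _ _ _ (MeasurableSpace.generateFrom (LipSets T ρ)) _ _ _ _ fun t => ?_
    exact MeasurableSpace.measurableSet_generateFrom (LipSets_Ioi hρ (hΦL q) t)
  let s : Set X := s0 ∩ ⋂ k : ℤ, (⇑(T ^ k)) ⁻¹' s1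
  have hsm : MeasurableSet s :=
    hs0.inter (MeasurableSet.iInter fun k => (zpow_mp hT hT' k).measurable hs1)
  have hsae : ∀ᵐ x ∂μ, x ∈ s := by
    have h0 : ∀ᵐ x ∂μ, x ∈ s0 := hs0n
    have h1 : ∀ᵐ x ∂μ, x ∈ s1 := hs1n
    have h2 : ∀ᵐ x ∂μ, ∀ k : ℤ, (T ^ k) x ∈ s1 :=
      ae_all_iff.2 fun k => (zpow_mp hT hT' k).quasiMeasurePreserving.ae h1
    filter_upwards [h0, h2] with x h0 h2
    exact ⟨h0, mem_iInter.2 h2⟩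
  have hinj : InjOn Φ s := by
    intro x hx y hy hxy
    by_contra hne
    obtain ⟨k, hk⟩ := hsep x hx.1 y hy.1 hne
    obtain ⟨d, hd, hdx⟩ := hDd _ (mem_iInter.1 hx.2 k) (min (ρ ((T ^ k) x) ((T ^ k) y) / 2) 1)
      (lt_min (half_pos hk) one_pos)
    have h1 := lt_min_iff.1 hdx
    have h2 : min (ρ ((T ^ k) x) d) 1 = min (ρ ((T ^ k) y) d) 1 := congrFun hxy (⟨d, hd⟩, k)
    rw [min_eq_left h1.2.le] at h2
    have h3 : ρ ((T ^ k) y) d = ρ ((T ^ k) x) d := by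
      rcases min_choice (ρ ((T ^ k) y) d) 1 with h4 | h4
      · rw [h2, h4]
      · rw [h4] at h2; linarith
    have h5 := hρ.triangle ((T ^ k) x) d ((T ^ k) y)
    rw [hρ.symm d] at h5
    linarith
  refine Integrable.ae_eq_zero_of_forall_setIntegral_eq_zero hv fun B hB _ => ?_
  have hI : MeasurableSet (Φ '' (B ∩ s)) :=
    (hB.inter hsm).image_of_measurable_injOn hΦm (hinj.mono inter_subset_right)
  have := (LipSets_integral hρ hv h _ (hΦg hI)).2
  rw [← this]
  refine setIntegral_congr_set ?_
  filter_upwards [hsae] with x hx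
  refine propext ⟨fun hxB => ⟨x, ⟨hxB, hx⟩, rfl⟩, ?_⟩
  rintro ⟨y, ⟨hyB, hys⟩, hyx⟩
  have : y = x := hinj hys hx hyx
  exact this ▸ hyB

end MeasThree

section Final
variable {X : Type*} [MeasurableSpace X]

lemma inner_real_eq {μ : Measure X} {g : X → ℝ} (hml : MemLp (fun x => (g x : ℂ)) 2 μ)
    (v : Lp ℂ 2 μ) : inner ℂ (hml.toLp _) v = ∫ x, (g x : ℂ) * v x ∂μ := by
  rw [L2.inner_def]
  refine integral_congr_ae ?_
  filter_upwards [hml.coeFn_toLp] with x hx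
  rw [hx]
  simp [mul_comm]

lemma koopman_total [StandardBorelSpace X] {μ : Measure X} [IsProbabilityMeasure μ]
    {T : Equiv.Perm X} {ρ : X → X → ℝ} (hρ : IsSemimetric ρ)
    (hm : Measurable (fun p : X × X => ρ p.1 p.2))
    (hT : MeasurePreserving T μ μ) (hT' : Measurable T.symm)
    (hadm : IsAdmissible μ ρ) (hgen : IsGenerating μ T ρ)
    (hs : IsScalingSeq μ T ρ (fun _ => 1)) (v : Lp ℂ 2 μ)
    (hv : ∀ (c : ℂ) (u : Lp ℂ 2 μ), Lp.compMeasurePreservingₗᵢ ℂ T hT u = c • u →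
      inner ℂ u v = 0) : v = 0 := by
  have hvi : Integrable (v : X → ℂ) μ := (Lp.memLp v).integrable (by norm_num)
  have h0 : (v : X → ℂ) =ᵐ[μ] 0 := by
    refine total_zero hρ hm hT hT' hadm hgen hvi ?_
    intro g hg
    obtain ⟨hgm, ⟨M, hM, hgM⟩, C, c, hC, hc, h⟩ := hg
    have hml := memLp_real (μ := μ) hgm M hgM
    have hcr := crit_hyp hT hs hgm M C c hM hC hc hgM h hml
    have hsu := koopman_surj hT hT'
    have h1 : inner ℂ v (hml.toLp (fun x => (g x : ℂ))) = 0 := by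
      generalize hml.toLp (fun x => (g x : ℂ)) = G at hcr ⊢
      generalize (Lp.compMeasurePreservingₗᵢ ℂ T hT : Lp ℂ 2 μ →ₗᵢ[ℂ] Lp ℂ 2 μ) = U at hcr hv hsu
      have h2 := crit (H := Lp ℂ 2 μ) U hsu G M hM
      have h3 := h2 hcr
      exact h3 v hv
    rw [inner_eq_zero_symm] at h1
    rw [← inner_real_eq hml, h1]
  exact (Lp.eq_zero_iff_ae_eq_zero).2 h0

lemma koopman_eig {μ : Measure X} {T : X → X} (hT : MeasurePreserving T μ μ) (f : Lp ℂ 2 μ)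
    (c : ℂ) (h : Lp.compMeasurePreservingₗᵢ ℂ T hT f = c • f) :
    (fun x => f (T x)) =ᵐ[μ] fun x => c * f x := by
  have h1 := Lp.coeFn_compMeasurePreserving f hT
  have h2 := Lp.coeFn_smul c f
  have h3 : Lp.compMeasurePreserving T hT f = c • f := h
  rw [h3] at h1
  filter_upwards [h1, h2] with x h1 h2
  rw [h2] at h1
  simpa using h1.symm

end Final

/-- If the class of scaling entropy sequences of an ergodic automorphism of a
standard probability space consists exactly of all positive sequences bounded and separated
from zero, then the system has purely point spectrum. -/
theorem purePointSpectrum_of_scalingEntropySeq_bounded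
    {X : Type*} [MeasurableSpace X] [StandardBorelSpace X]
    (μ : Measure X) [IsProbabilityMeasure μ]
    (T : Equiv.Perm X) (hT : Measurable (⇑T)) (hTsymm : Measurable (⇑T.symm))
    (hTerg : Ergodic (⇑T) μ)
    (hchar : ∀ h : ℕ → ℝ, IsScalingEntropySeq μ T h ↔
      ∃ c C : ℝ, 0 < c ∧ ∀ n : ℕ, 1 ≤ n → c ≤ h n ∧ h n ≤ C) :
    HasPurePointSpectrum μ (⇑T) := by
  have hmp : MeasurePreserving (⇑T) μ μ := hTerg.toMeasurePreserving
  obtain ⟨ρ, hρ, hm, -, hadm, hgen, hs⟩ := (hchar (fun _ => 1)).2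
    ⟨1, 1, one_pos, fun n _ => ⟨le_rfl, le_rfl⟩⟩
  have : Fact ((2 : ℝ≥0∞) ≠ ⊤) := ⟨by norm_num⟩
  obtain ⟨ι, b, hb⟩ := eigen_basis (H := Lp ℂ 2 μ) (Lp.compMeasurePreservingₗᵢ ℂ T hmp)
    (koopman_total hρ hm hmp hTsymm hadm hgen hs)
  refine ⟨ι, b, fun i => ?_⟩
  obtain ⟨c, hc⟩ := hb i
  exact ⟨c, koopman_eig hmp (b i) c hc⟩
end
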